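/- arXiv:math/0611319 — 7 statements merged into one kernel-verified Lean document; each statement's English description precedes it below -/
import Mathlib

section
/- Let α > 0 and let v, φ, ψ : ℝ → ℝ be smooth 2π-periodic functions with v > 0 and φ > 0 everywhere. For a smooth positive 2π-periodic function w define the α-scalar curvature R^α_w(θ) = w(θ)³·(α·w''(θ) + w(θ)), and for the metric w^{-4}·(dθ⊗dθ) define the conformal Laplace–Beltrami operator acting on a smooth function f by Δ_w f (θ) = w(θ)²·(w(θ)²·f'(θ))'. Then for all θ: α·(vφ)(θ)²·((vφ)²·ψ')'(θ) + R^α_{vφ}(θ)·ψ(θ) = φ(θ)³·( α·v(θ)²·(v²·(ψφ)')'(θ) + R^α_v(θ)·(ψφ)(θ) ). In particular (taking ψ ≡ 1), R^α_{vφ}(θ) = φ(θ)³·( α·v(θ)²·(v²·φ')'(θ) + R^α_v(θ)·φ(θ) ). -/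
open Real MeasureTheory

/-- The weighted second derivative `(f² g')'` in terms of the derivatives of `f` and `g`. -/
lemma deriv_sq_mul_deriv {f g : ℝ → ℝ} (hf : Differentiable ℝ f)
    (hg : Differentiable ℝ (deriv g)) (x : ℝ) :
    deriv (fun y => f y ^ 2 * deriv g y) x
      = 2 * f x * deriv f x * deriv g x + f x ^ 2 * deriv (deriv g) x := by
  have h := ((hf x).hasDerivAt.fun_pow 2).fun_mul (hg x).hasDerivAt
  rw [h.deriv]
  ring

lemma deriv_fun_mul_eq {f g : ℝ → ℝ} (hf : Differentiable ℝ f) (hg : Differentiable ℝ g) :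
    deriv (fun y => f y * g y) = fun y => deriv f y * g y + f y * deriv g y :=
  funext fun x => deriv_fun_mul (hf x) (hg x)

lemma hasDerivAt_deriv_fun_mul {f g : ℝ → ℝ} (hf : Differentiable ℝ f) (hg : Differentiable ℝ g)
    (hf' : Differentiable ℝ (deriv f)) (hg' : Differentiable ℝ (deriv g)) (x : ℝ) :
    HasDerivAt (deriv fun y => f y * g y)
      (deriv (deriv f) x * g x + 2 * (deriv f x * deriv g x) + f x * deriv (deriv g) x) x := by
  rw [deriv_fun_mul_eq hf hg]
  refine (((hf' x).hasDerivAt.fun_mul (hg x).hasDerivAt).fun_add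
    ((hf x).hasDerivAt.fun_mul (hg' x).hasDerivAt)).congr_deriv ?_
  ring

/-- Conformal covariance of the α-conformal Laplace–Beltrami operator on S¹:
for `g₁ = v⁻⁴ g_s` and `g₂ = (vφ)⁻⁴ g_s`, one has `L^α_{g₂} ψ = φ³ L^α_{g₁}(ψφ)`,
and in particular (ψ ≡ 1) `R^α_{vφ} = φ³ L^α_v φ`. -/
theorem conformal_covariance
    (α : ℝ) (hα : 0 < α) (v φ ψ : ℝ → ℝ)
    (hv : ContDiff ℝ (⊤ : ℕ∞) v) (hφ : ContDiff ℝ (⊤ : ℕ∞) φ) (hψ : ContDiff ℝ (⊤ : ℕ∞) ψ)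
    (hvper : ∀ θ, v (θ + 2 * π) = v θ)
    (hφper : ∀ θ, φ (θ + 2 * π) = φ θ)
    (hψper : ∀ θ, ψ (θ + 2 * π) = ψ θ)
    (hvpos : ∀ θ, 0 < v θ) (hφpos : ∀ θ, 0 < φ θ) :
    (∀ θ : ℝ,
      α * ((v θ * φ θ) ^ 2 * deriv (fun x => (v x * φ x) ^ 2 * deriv ψ x) θ)
        + ((v θ * φ θ) ^ 3 *
            (α * deriv (deriv (fun x => v x * φ x)) θ + v θ * φ θ)) * ψ θ
      = (φ θ) ^ 3 *
          (α * ((v θ) ^ 2 * deriv (fun x => (v x) ^ 2 * deriv (fun y => ψ y * φ y) x) θ)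
            + ((v θ) ^ 3 * (α * deriv (deriv v) θ + v θ)) * (ψ θ * φ θ)))
    ∧ (∀ θ : ℝ,
      (v θ * φ θ) ^ 3 * (α * deriv (deriv (fun x => v x * φ x)) θ + v θ * φ θ)
      = (φ θ) ^ 3 *
          (α * ((v θ) ^ 2 * deriv (fun x => (v x) ^ 2 * deriv φ x) θ)
            + ((v θ) ^ 3 * (α * deriv (deriv v) θ + v θ)) * φ θ)) := by
  have diff {f : ℝ → ℝ} (hf : ContDiff ℝ (⊤ : ℕ∞) f) :
      Differentiable ℝ f ∧ Differentiable ℝ (deriv f) :=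
    ⟨hf.differentiable (by simp), (contDiff_infty_iff_deriv.1 hf).2.differentiable (by simp)⟩
  obtain ⟨dv, dv'⟩ := diff hv
  obtain ⟨dφ, dφ'⟩ := diff hφ
  obtain ⟨dψ, dψ'⟩ := diff hψ
  have hvφ := hasDerivAt_deriv_fun_mul dv dφ dv' dφ'
  have hψφ := hasDerivAt_deriv_fun_mul dψ dφ dψ' dφ'
  refine ⟨fun θ => ?_, fun θ => ?_⟩
  · rw [deriv_sq_mul_deriv (dv.fun_mul dφ) dψ',
      deriv_sq_mul_deriv dv fun x => (hψφ x).differentiableAt,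
      (hvφ θ).deriv, (hψφ θ).deriv, deriv_fun_mul_eq dv dφ, deriv_fun_mul_eq dψ dφ]
    ring
  · rw [deriv_sq_mul_deriv dv dφ', (hvφ θ).deriv]
    ring
end

section
/- Let α > 0 and let u : ℝ × [0,∞) → ℝ be a smooth function, 2π-periodic in its first variable, with u(θ,t) > 0 everywhere, satisfying the normalized α-flow equation ∂_t u = (1/4)(R − R̄)·u, where R(θ,t) = u(θ,t)³·(α·∂²_θ u(θ,t) + u(θ,t)) and R̄(t) = (∫_0^{2π} R(θ,t)·u(θ,t)^{−2} dθ)/(∫_0^{2π} u(θ,t)^{−2} dθ). Then R satisfies the evolution equation ∂_t R(θ,t) = (α/4)·u(θ,t)²·∂_θ( u(θ,t)²·∂_θ R(θ,t) ) + R(θ,t)·( R(θ,t) − R̄(t) ) for all θ and t. -/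
/-- Smooth functions on the plane have differentiable slices in the first variable. -/
lemma hasDerivAt_fst_slice {f : ℝ → ℝ → ℝ}
    (hf : ContDiff ℝ (⊤ : ℕ∞) (fun p : ℝ × ℝ => f p.1 p.2)) (x t : ℝ) :
    HasDerivAt (fun y => f y t) (fderiv ℝ (fun p : ℝ × ℝ => f p.1 p.2) (x, t) (1, 0)) x :=
  ((hf.differentiable (by simp)) (x, t)).hasFDerivAt.comp_hasDerivAt
    (f := fun y => (y, t)) x ((hasDerivAt_id x).prodMk (hasDerivAt_const x t))

/-- Smooth functions on the plane have differentiable slices in the second variable. -/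
lemma hasDerivAt_snd_slice {f : ℝ → ℝ → ℝ}
    (hf : ContDiff ℝ (⊤ : ℕ∞) (fun p : ℝ × ℝ => f p.1 p.2)) (x t : ℝ) :
    HasDerivAt (fun s => f x s) (fderiv ℝ (fun p : ℝ × ℝ => f p.1 p.2) (x, t) (0, 1)) t :=
  ((hf.differentiable (by simp)) (x, t)).hasFDerivAt.comp_hasDerivAt
    (f := fun s => (x, s)) t ((hasDerivAt_const t x).prodMk (hasDerivAt_id t))

lemma contDiff_deriv_fst {f : ℝ → ℝ → ℝ}
    (hf : ContDiff ℝ (⊤ : ℕ∞) (fun p : ℝ × ℝ => f p.1 p.2)) :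
    ContDiff ℝ (⊤ : ℕ∞) (fun p : ℝ × ℝ => deriv (fun y => f y p.2) p.1) := by
  simp_rw [fun p : ℝ × ℝ => (hasDerivAt_fst_slice hf p.1 p.2).deriv]
  exact (hf.fderiv_right (by simp)).clm_apply contDiff_const

lemma contDiff_deriv_snd {f : ℝ → ℝ → ℝ}
    (hf : ContDiff ℝ (⊤ : ℕ∞) (fun p : ℝ × ℝ => f p.1 p.2)) :
    ContDiff ℝ (⊤ : ℕ∞) (fun p : ℝ × ℝ => deriv (fun s => f p.1 s) p.2) := by
  simp_rw [fun p : ℝ × ℝ => (hasDerivAt_snd_slice hf p.1 p.2).deriv]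
  exact (hf.fderiv_right (by simp)).clm_apply contDiff_const

/-- Mixed partial derivatives of a smooth function on the plane commute. -/
lemma deriv_snd_deriv_fst_comm {f : ℝ → ℝ → ℝ}
    (hf : ContDiff ℝ (⊤ : ℕ∞) (fun p : ℝ × ℝ => f p.1 p.2)) (x t : ℝ) :
    deriv (fun s => deriv (fun y => f y s) x) t = deriv (fun y => deriv (fun s => f y s) t) x := by
  have hd : DifferentiableAt ℝ (fderiv ℝ (fun p : ℝ × ℝ => f p.1 p.2)) (x, t) :=
    (hf.fderiv_right (m := (⊤ : ℕ∞)) (by simp)).differentiable (by simp) _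
  have h1 := hasDerivAt_snd_slice (f := fun x s => deriv (fun y => f y s) x)
    (contDiff_deriv_fst hf) x t
  have h2 := hasDerivAt_fst_slice (f := fun x t => deriv (fun s => f x s) t)
    (contDiff_deriv_snd hf) x t
  rw [h1.deriv, h2.deriv]
  simp_rw [fun p : ℝ × ℝ => (hasDerivAt_fst_slice hf p.1 p.2).deriv,
    fun p : ℝ × ℝ => (hasDerivAt_snd_slice hf p.1 p.2).deriv]
  have hsymm : IsSymmSndFDerivAt ℝ (fun p : ℝ × ℝ => f p.1 p.2) (x, t) :=
    hf.contDiffAt.isSymmSndFDerivAt (by simpa using WithTop.coe_le_coe.2 (le_top (a := (2 : ℕ∞))))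
  rw [fderiv_clm_apply hd (differentiableAt_const _),
    fderiv_clm_apply hd (differentiableAt_const _)]
  simpa using hsymm (0, 1) (1, 0)

open Real MeasureTheory

/-- Along the normalized α-scalar curvature flow `∂ₜu = ¼(R − R̄)u` on S¹,
the curvature satisfies `∂ₜR = (α/4)Δ_g R + R(R − R̄)`,
where `Δ_g f = u²(u² f_θ)_θ`. -/
theorem curvature_evolution
    (α : ℝ) (hα : 0 < α) (u : ℝ → ℝ → ℝ)
    (hu : ContDiff ℝ (⊤ : ℕ∞) (fun p : ℝ × ℝ => u p.1 p.2))
    (huper : ∀ θ t, u (θ + 2 * π) t = u θ t)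
    (hupos : ∀ θ t, 0 < u θ t)
    (R : ℝ → ℝ → ℝ)
    (hR : ∀ θ t, R θ t = (u θ t) ^ 3 * (α * deriv (deriv (fun x => u x t)) θ + u θ t))
    (Rbar : ℝ → ℝ)
    (hRbar : ∀ t, Rbar t =
      (∫ θ in (0:ℝ)..(2 * π), R θ t * ((u θ t) ^ 2)⁻¹) /
        ∫ θ in (0:ℝ)..(2 * π), ((u θ t) ^ 2)⁻¹)
    (hflow : ∀ θ t, 0 ≤ t →
      deriv (fun s => u θ s) t = (1 / 4) * (R θ t - Rbar t) * u θ t) :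
    ∀ θ t, 0 ≤ t →
      deriv (fun s => R θ s) t
        = (α / 4) * ((u θ t) ^ 2 * deriv (fun x => (u x t) ^ 2 * deriv (fun y => R y t) x) θ)
          + R θ t * (R θ t - Rbar t) := by
  intro θ t ht
  have hu₁ := contDiff_deriv_fst hu
  have hu₂ : ContDiff ℝ (⊤ : ℕ∞)
      (fun p : ℝ × ℝ => deriv (fun x => deriv (fun y => u y p.2) x) p.1) :=
    contDiff_deriv_fst (f := fun x s => deriv (fun y => u y s) x) hu₁
  have hRs : ContDiff ℝ (⊤ : ℕ∞) (fun p : ℝ × ℝ => R p.1 p.2) := by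
    simp_rw [hR]
    exact (hu.pow 3).mul ((contDiff_const.mul hu₂).add hu)
  have hR₁ := contDiff_deriv_fst hRs
  have du (x) : HasDerivAt (fun y => u y t) (deriv (fun y => u y t) x) x :=
    (hasDerivAt_fst_slice hu x t).differentiableAt.hasDerivAt
  have du₁ (x) : HasDerivAt (fun y => deriv (fun z => u z t) y)
      (deriv (deriv (fun y => u y t)) x) x :=
    (hasDerivAt_fst_slice (f := fun x s => deriv (fun y => u y s) x) hu₁
      x t).differentiableAt.hasDerivAt
  have dR (x) : HasDerivAt (fun y => R y t) (deriv (fun y => R y t) x) x :=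
    (hasDerivAt_fst_slice hRs x t).differentiableAt.hasDerivAt
  have dR₁ (x) : HasDerivAt (fun y => deriv (fun z => R z t) y)
      (deriv (deriv (fun y => R y t)) x) x :=
    (hasDerivAt_fst_slice (f := fun x s => deriv (fun y => R y s) x) hR₁
      x t).differentiableAt.hasDerivAt
  have dtu : HasDerivAt (fun s => u θ s) ((1 / 4) * (R θ t - Rbar t) * u θ t) t := by
    rw [← hflow θ t ht]
    exact (hasDerivAt_snd_slice hu θ t).differentiableAt.hasDerivAt
  have dxut (x) : deriv (fun y => deriv (fun s => u y s) t) x =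
      (1 / 4) * (deriv (fun y => R y t) x * u x t
        + (R x t - Rbar t) * deriv (fun y => u y t) x) := by
    simp_rw [fun y => hflow y t ht]
    rw [((((dR x).sub_const (Rbar t)).const_mul (1 / 4)).fun_mul (du x)).deriv]
    ring
  have dtu₂ : HasDerivAt (fun s => deriv (deriv (fun x => u x s)) θ)
      ((1 / 4) * (deriv (deriv (fun y => R y t)) θ * u θ t
        + 2 * (deriv (fun y => R y t) θ * deriv (fun y => u y t) θ)
        + (R θ t - Rbar t) * deriv (deriv (fun y => u y t)) θ)) t := by
    have h := (hasDerivAt_snd_slice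
      (f := fun x s => deriv (fun z => deriv (fun y => u y s) z) x)
      hu₂ θ t).differentiableAt.hasDerivAt
    rw [deriv_snd_deriv_fst_comm (f := fun x s => deriv (fun y => u y s) x) hu₁] at h
    simp_rw [deriv_snd_deriv_fst_comm hu, dxut] at h
    rw [((((dR₁ θ).fun_mul (du θ)).fun_add
      (((dR θ).sub_const (Rbar t)).fun_mul (du₁ θ))).const_mul (1 / 4)).deriv] at h
    refine h.congr_deriv ?_
    ring
  have dtR := (dtu.fun_pow 3).fun_mul ((dtu₂.const_mul α).fun_add dtu)
  have hRt : (fun s => R θ s) =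
      fun s => u θ s ^ 3 * (α * deriv (deriv (fun x => u x s)) θ + u θ s) :=
    funext (hR θ)
  rw [hRt]
  refine dtR.deriv.trans ?_
  rw [(((du θ).fun_pow 2).fun_mul (dR₁ θ)).deriv]
  have e := hR θ t
  push_cast
  linear_combination (-(R θ t - Rbar t)) * e
end

section
/- Let α > 0 and let u : ℝ × [0,∞) → ℝ be a smooth function, 2π-periodic in its first variable, with u(θ,t) > 0 everywhere, satisfying ∂_t u = (1/4)(R − R̄)·u, where R(θ,t) = u³·(α·∂²_θ u + u) and R̄(t) = (∫_0^{2π} R u^{−2} dθ)/(∫_0^{2π} u^{−2} dθ), and assume the normalization ∫_0^{2π} u(θ,0)^{−2} dθ = 2π. Then for all t ≥ 0, d/dt R̄(t) = (1/(4π))·∫_0^{2π} ( R(θ,t) − R̄(t) )²·u(θ,t)^{−2} dθ. In particular R̄(t) is nondecreasing in t, and is strictly increasing unless R(·,t) is constant in θ. -/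
open Real MeasureTheory

/-- Differentiation under the integral sign for a jointly continuous family with jointly
continuous time derivative. -/
theorem hasDerivAt_intervalIntegral_of_continuous {F F' : ℝ × ℝ → ℝ} (a b : ℝ)
    (hF : Continuous F) (hF' : Continuous F')
    (hd : ∀ θ t, HasDerivAt (fun s => F (θ, s)) (F' (θ, t)) t) (t : ℝ) :
    HasDerivAt (fun s => ∫ θ in a..b, F (θ, s)) (∫ θ in a..b, F' (θ, t)) t := by
  obtain ⟨C, hC⟩ := ((isCompact_uIcc (a := a) (b := b)).prod
    (isCompact_closedBall t 1)).exists_bound_of_continuousOn hF'.continuousOn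
  refine (intervalIntegral.hasDerivAt_integral_of_dominated_loc_of_deriv_le
    (F := fun s θ => F (θ, s)) (F' := fun s θ => F' (θ, s)) (bound := fun _ => C)
    (Metric.closedBall_mem_nhds t one_pos) ?_ ?_ ?_ ?_ ?_ ?_).2
  · exact .of_forall fun s => (by fun_prop : Continuous fun θ => F (θ, s)).aestronglyMeasurable
  · exact (by fun_prop : Continuous fun θ => F (θ, t)).intervalIntegrable _ _
  · exact (by fun_prop : Continuous fun θ => F' (θ, t)).aestronglyMeasurable
  · exact .of_forall fun θ hθ s hs => hC (θ, s) ⟨Set.uIoc_subset_uIcc hθ, hs⟩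
  · exact intervalIntegrable_const
  · exact .of_forall fun θ _ s _ => hd θ s

/-- Partial derivative in the first variable. -/
noncomputable def partialFst (F : ℝ × ℝ → ℝ) (p : ℝ × ℝ) : ℝ := fderiv ℝ F p (1, 0)

/-- Partial derivative in the second variable. -/
noncomputable def partialSnd (F : ℝ × ℝ → ℝ) (p : ℝ × ℝ) : ℝ := fderiv ℝ F p (0, 1)

section Partial

variable {F : ℝ × ℝ → ℝ}

theorem ContDiff.partialFst (hF : ContDiff ℝ (⊤ : ℕ∞) F) :
    ContDiff ℝ (⊤ : ℕ∞) (partialFst F) :=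
  (hF.fderiv_right (m := (⊤ : ℕ∞)) (by simp)).clm_apply contDiff_const

theorem ContDiff.partialSnd (hF : ContDiff ℝ (⊤ : ℕ∞) F) :
    ContDiff ℝ (⊤ : ℕ∞) (partialSnd F) :=
  (hF.fderiv_right (m := (⊤ : ℕ∞)) (by simp)).clm_apply contDiff_const

theorem hasDerivAt_partialFst (hF : ContDiff ℝ (⊤ : ℕ∞) F) (θ t : ℝ) :
    HasDerivAt (fun x => F (x, t)) (partialFst F (θ, t)) θ :=
  ((hF.differentiable (by simp)) (θ, t)).hasFDerivAt.comp_hasDerivAt θ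
    ((hasDerivAt_id θ).prodMk (hasDerivAt_const θ t))

theorem hasDerivAt_partialSnd (hF : ContDiff ℝ (⊤ : ℕ∞) F) (θ t : ℝ) :
    HasDerivAt (fun s => F (θ, s)) (partialSnd F (θ, t)) t :=
  ((hF.differentiable (by simp)) (θ, t)).hasFDerivAt.comp_hasDerivAt t
    ((hasDerivAt_const t θ).prodMk (hasDerivAt_id t))

theorem partialSnd_partialFst (hF : ContDiff ℝ (⊤ : ℕ∞) F) :
    partialSnd (partialFst F) = partialFst (partialSnd F) := by
  funext p
  have hd : DifferentiableAt ℝ (fderiv ℝ F) p :=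
    (hF.fderiv_right (m := (⊤ : ℕ∞)) (by simp)).differentiable (by simp) p
  have hs : IsSymmSndFDerivAt ℝ F p :=
    hF.contDiffAt.isSymmSndFDerivAt (by
      rw [minSmoothness_of_isRCLikeNormedField]
      exact WithTop.coe_le_coe.2 le_top)
  have key (v w : ℝ × ℝ) :
      fderiv ℝ (fun q => fderiv ℝ F q v) p w = fderiv ℝ (fderiv ℝ F) p w v := by
    rw [fderiv_clm_apply hd (differentiableAt_const v)]
    simp
  exact (key (1, 0) (0, 1)).trans ((hs _ _).trans (key (0, 1) (1, 0)).symm)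

theorem fderiv_add_fst_of_periodic {c : ℝ} (hF : ∀ θ t, F (θ + c, t) = F (θ, t)) (θ t : ℝ) :
    fderiv ℝ F (θ + c, t) = fderiv ℝ F (θ, t) := by
  have h : (fun p => F (p + (c, 0))) = F := by
    funext ⟨x, s⟩
    simpa using hF x s
  have := fderiv_comp_add_right (𝕜 := ℝ) (f := F) (x := (θ, t)) (c, 0)
  rw [h] at this
  simpa using this.symm

theorem partialFst_periodic {c : ℝ} (hF : ∀ θ t, F (θ + c, t) = F (θ, t)) (θ t : ℝ) :
    partialFst F (θ + c, t) = partialFst F (θ, t) := by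
  simp only [partialFst, fderiv_add_fst_of_periodic hF]

theorem partialSnd_periodic {c : ℝ} (hF : ∀ θ t, F (θ + c, t) = F (θ, t)) (θ t : ℝ) :
    partialSnd F (θ + c, t) = partialSnd F (θ, t) := by
  simp only [partialSnd, fderiv_add_fst_of_periodic hF]

end Partial

/-- The second derivative is symmetric with respect to the `L²` pairing on periodic functions. -/
theorem integral_mul_partialFst_partialFst_comm {F G : ℝ × ℝ → ℝ} {c : ℝ}
    (hF : ContDiff ℝ (⊤ : ℕ∞) F) (hG : ContDiff ℝ (⊤ : ℕ∞) G)
    (hFper : ∀ θ t, F (θ + c, t) = F (θ, t)) (hGper : ∀ θ t, G (θ + c, t) = G (θ, t)) (t : ℝ) :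
    ∫ θ in (0:ℝ)..c, (F (θ, t) * partialFst (partialFst G) (θ, t)
      - partialFst (partialFst F) (θ, t) * G (θ, t)) = 0 := by
  have h1 := hF.continuous
  have h2 := hG.continuous
  have h3 := hF.partialFst.partialFst.continuous
  have h4 := hG.partialFst.partialFst.continuous
  rw [intervalIntegral.integral_eq_sub_of_hasDerivAt
    (f := fun θ => F (θ, t) * partialFst G (θ, t) - partialFst F (θ, t) * G (θ, t))]
  · have e1 := hFper 0 t
    have e2 := hGper 0 t
    have e3 := partialFst_periodic hFper 0 t
    have e4 := partialFst_periodic hGper 0 t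
    rw [zero_add] at e1 e2 e3 e4
    rw [e1, e2, e3, e4, sub_self]
  · intro θ _
    exact (((hasDerivAt_partialFst hF θ t).mul (hasDerivAt_partialFst hG.partialFst θ t)).sub
      ((hasDerivAt_partialFst hF.partialFst θ t).mul (hasDerivAt_partialFst hG θ t))).congr_deriv
      (by ring)
  · exact (by fun_prop : Continuous _).intervalIntegrable _ _

/-- Along the normalized α-scalar curvature flow on S¹ (length normalized to 2π),
the average curvature satisfies `d/dt R̄ = (1/4π)∫ (R − R̄)² dσ`; in particular `R̄`
is nondecreasing, and strictly increasing unless `R(·,t)` is constant. -/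
theorem average_curvature_increasing
    (α : ℝ) (hα : 0 < α) (u : ℝ → ℝ → ℝ)
    (hu : ContDiff ℝ (⊤ : ℕ∞) (fun p : ℝ × ℝ => u p.1 p.2))
    (huper : ∀ θ t, u (θ + 2 * π) t = u θ t)
    (hupos : ∀ θ t, 0 < u θ t)
    (R : ℝ → ℝ → ℝ)
    (hR : ∀ θ t, R θ t = (u θ t) ^ 3 * (α * deriv (deriv (fun x => u x t)) θ + u θ t))
    (Rbar : ℝ → ℝ)
    (hRbar : ∀ t, Rbar t =
      (∫ θ in (0:ℝ)..(2 * π), R θ t * ((u θ t) ^ 2)⁻¹) /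
        ∫ θ in (0:ℝ)..(2 * π), ((u θ t) ^ 2)⁻¹)
    (hflow : ∀ θ t, 0 ≤ t →
      deriv (fun s => u θ s) t = (1 / 4) * (R θ t - Rbar t) * u θ t)
    (hnorm : ∫ θ in (0:ℝ)..(2 * π), ((u θ 0) ^ 2)⁻¹ = 2 * π) :
    (∀ t, 0 ≤ t →
      deriv Rbar t
        = (1 / (4 * π)) * ∫ θ in (0:ℝ)..(2 * π), (R θ t - Rbar t) ^ 2 * ((u θ t) ^ 2)⁻¹)
    ∧ MonotoneOn Rbar (Set.Ici 0)
    ∧ (∀ t, 0 ≤ t → (¬ ∃ c : ℝ, ∀ θ, R θ t = c) → 0 < deriv Rbar t) := by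
  set U : ℝ × ℝ → ℝ := fun p => u p.1 p.2
  set V := partialSnd U
  set Q := partialFst (partialFst U) with hQ
  have hUper : ∀ θ t, U (θ + 2 * π, t) = U (θ, t) := huper
  have hUpos : ∀ p, 0 < U p := fun p => hupos p.1 p.2
  have hUne : ∀ p, U p ≠ 0 := fun p => (hUpos p).ne'
  have hVs : ContDiff ℝ (⊤ : ℕ∞) V := hu.partialSnd
  have hQs : ContDiff ℝ (⊤ : ℕ∞) Q := hu.partialFst.partialFst
  have hUc : Continuous U := hu.continuous
  have hVc : Continuous V := hVs.continuous
  have hQc : Continuous Q := hQs.continuous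
  have hVQc : Continuous (partialFst (partialFst V)) := hVs.partialFst.partialFst.continuous
  have hQt : partialSnd Q = partialFst (partialFst V) := by
    rw [hQ, partialSnd_partialFst hu.partialFst, partialSnd_partialFst hu]
  have hR' : ∀ θ t, R θ t = U (θ, t) ^ 3 * (α * Q (θ, t) + U (θ, t)) := by
    intro θ t
    have h : deriv (fun x => u x t) = fun x => partialFst U (x, t) :=
      funext fun x => (hasDerivAt_partialFst hu x t).deriv
    rw [hR, h, (hasDerivAt_partialFst hu.partialFst θ t).deriv]
  have hV' : ∀ θ t, 0 ≤ t → V (θ, t) = 1 / 4 * (R θ t - Rbar t) * U (θ, t) := by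
    intro θ t ht
    rw [← hflow θ t ht]
    exact (hasDerivAt_partialSnd hu θ t).deriv.symm
  have hRc : ∀ t, Continuous fun θ => R θ t := by
    intro t
    simp only [hR']
    fun_prop
  have hWc : Continuous fun p => (U p ^ 2)⁻¹ := (hUc.pow 2).inv₀ fun p => pow_ne_zero 2 (hUne p)
  have hW3c : Continuous fun p => (U p ^ 3)⁻¹ := (hUc.pow 3).inv₀ fun p => pow_ne_zero 3 (hUne p)
  have hWtc : ∀ t, Continuous fun θ => (u θ t ^ 2)⁻¹ := fun t =>
    hWc.comp (by fun_prop : Continuous fun θ : ℝ => (θ, t))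
  set L : ℝ → ℝ := fun t => ∫ θ in (0:ℝ)..(2 * π), (u θ t ^ 2)⁻¹
  set A : ℝ → ℝ := fun t => ∫ θ in (0:ℝ)..(2 * π), R θ t * (u θ t ^ 2)⁻¹
  have hLpos : ∀ t, 0 < L t := fun t =>
    intervalIntegral.intervalIntegral_pos_of_pos ((hWtc t).intervalIntegrable _ _)
      (fun θ => inv_pos.2 (pow_pos (hupos θ t) 2)) two_pi_pos
  have hLd : ∀ t, HasDerivAt L
      (∫ θ in (0:ℝ)..(2 * π), -2 * V (θ, t) * (U (θ, t) ^ 3)⁻¹) t := by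
    refine hasDerivAt_intervalIntegral_of_continuous (F := fun p => (U p ^ 2)⁻¹)
      (F' := fun p => -2 * V p * (U p ^ 3)⁻¹) _ _ hWc (by fun_prop) fun θ t => ?_
    refine (((hasDerivAt_partialSnd hu θ t).pow 2).inv
      (pow_ne_zero 2 (hUne _))).congr_deriv ?_
    have := hUne (θ, t)
    change -(((2 : ℕ) : ℝ) * U (θ, t) ^ (2 - 1) * V (θ, t)) / (U (θ, t) ^ 2) ^ 2
      = -2 * V (θ, t) * (U (θ, t) ^ 3)⁻¹
    push_cast
    field_simp
  have hAU : A = fun t => ∫ θ in (0:ℝ)..(2 * π), U (θ, t) * (α * Q (θ, t) + U (θ, t)) := by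
    funext t
    refine intervalIntegral.integral_congr fun θ _ => ?_
    have := hUne (θ, t)
    change R θ t * (U (θ, t) ^ 2)⁻¹ = _
    rw [hR']
    field_simp
  have hAd : ∀ t, HasDerivAt A (∫ θ in (0:ℝ)..(2 * π), (V (θ, t) * (α * Q (θ, t) + U (θ, t))
      + U (θ, t) * (α * partialFst (partialFst V) (θ, t) + V (θ, t)))) t := by
    rw [hAU]
    refine hasDerivAt_intervalIntegral_of_continuous
      (F := fun p => U p * (α * Q p + U p))
      (F' := fun p => V p * (α * Q p + U p) + U p * (α * partialFst (partialFst V) p + V p))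
      _ _ (by fun_prop) (by fun_prop) fun θ t => ?_
    have hUt := hasDerivAt_partialSnd hu θ t
    have hQd := hasDerivAt_partialSnd hQs θ t
    rw [hQt] at hQd
    exact hUt.mul ((hQd.const_mul α).add hUt)
  have hRb : ∀ t, Rbar t * L t = A t := fun t => by
    rw [hRbar t]
    exact div_mul_cancel₀ _ (hLpos t).ne'
  have hmean : ∀ t, ∫ θ in (0:ℝ)..(2 * π), (R θ t - Rbar t) * (u θ t ^ 2)⁻¹ = 0 := by
    intro t
    have hWt := hWtc t
    have hRt := hRc t
    simp only [sub_mul]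
    rw [intervalIntegral.integral_sub ((by fun_prop : Continuous fun θ => R θ t * (u θ t ^ 2)⁻¹).intervalIntegrable _ _)
      ((hWt.const_mul _).intervalIntegrable _ _), intervalIntegral.integral_const_mul]
    exact sub_eq_zero.2 (hRb t).symm
  have hLd0 : ∀ t, 0 ≤ t → HasDerivAt L 0 t := by
    intro t ht
    refine (hLd t).congr_deriv ?_
    refine Eq.trans ?_ ((congrArg (-1 / 2 * ·) (hmean t)).trans (mul_zero (-1 / 2 : ℝ)))
    rw [← intervalIntegral.integral_const_mul]
    refine intervalIntegral.integral_congr fun θ _ => ?_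
    have := hUne (θ, t)
    change _ = -1 / 2 * ((R θ t - Rbar t) * (U (θ, t) ^ 2)⁻¹)
    simp only [hV' θ t ht]
    field_simp
    ring
  have hL2 : ∀ t, 0 ≤ t → L t = 2 * π := by
    intro t ht
    rw [← hnorm]
    exact constant_of_has_deriv_right_zero (a := 0) (b := t)
      (fun s _ => (hLd s).continuousAt.continuousWithinAt)
      (fun s hs => (hLd0 s hs.1).hasDerivWithinAt) t ⟨ht, le_rfl⟩
  have hAd' : ∀ t, 0 ≤ t → HasDerivAt A
      (1 / 2 * ∫ θ in (0:ℝ)..(2 * π), (R θ t - Rbar t) ^ 2 * (u θ t ^ 2)⁻¹) t := by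
    intro t ht
    refine (hAd t).congr_deriv ?_
    have hsym := integral_mul_partialFst_partialFst_comm hu hVs hUper
      (partialSnd_periodic hUper) t
    have hWt := hWtc t
    have hRt := hRc t
    have hQc' : Continuous (partialFst (partialFst U)) := hQc
    calc _ = ∫ θ in (0:ℝ)..(2 * π), (1 / 2 * ((R θ t - Rbar t) ^ 2 * (u θ t ^ 2)⁻¹)
          + Rbar t / 2 * ((R θ t - Rbar t) * (u θ t ^ 2)⁻¹)
          + α * (U (θ, t) * partialFst (partialFst V) (θ, t)
            - partialFst (partialFst U) (θ, t) * V (θ, t))) := by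
          refine intervalIntegral.integral_congr fun θ _ => ?_
          have hne := hUne (θ, t)
          have e : α * Q (θ, t) + U (θ, t) = R θ t * (U (θ, t) ^ 3)⁻¹ := by
            rw [hR']
            field_simp
          have hv := hV' θ t ht
          change _ = 1 / 2 * ((R θ t - Rbar t) ^ 2 * (U (θ, t) ^ 2)⁻¹)
            + Rbar t / 2 * ((R θ t - Rbar t) * (U (θ, t) ^ 2)⁻¹)
            + α * (U (θ, t) * partialFst (partialFst V) (θ, t) - Q (θ, t) * V (θ, t))
          have e2 : 2 * V (θ, t) * (α * Q (θ, t) + U (θ, t))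
              = 1 / 2 * ((R θ t - Rbar t) ^ 2 * (U (θ, t) ^ 2)⁻¹)
                + Rbar t / 2 * ((R θ t - Rbar t) * (U (θ, t) ^ 2)⁻¹) := by
            rw [e, hv]
            field_simp
            ring
          rw [← e2]
          ring
      _ = _ := by
          rw [intervalIntegral.integral_add, intervalIntegral.integral_add,
            intervalIntegral.integral_const_mul, intervalIntegral.integral_const_mul,
            intervalIntegral.integral_const_mul, hmean t, hsym]
          · ring
          all_goals exact (by fun_prop : Continuous _).intervalIntegrable _ _
  have hRfun : Rbar = fun t => A t / L t := funext hRbar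
  have hRdiff : ∀ t, DifferentiableAt ℝ Rbar t := by
    intro t
    rw [hRfun]
    exact ((hAd t).div (hLd t) (hLpos t).ne').differentiableAt
  have hderiv : ∀ t, 0 ≤ t → deriv Rbar t
      = (1 / (4 * π)) * ∫ θ in (0:ℝ)..(2 * π), (R θ t - Rbar t) ^ 2 * (u θ t ^ 2)⁻¹ := by
    intro t ht
    have h := ((hAd' t ht).div (hLd0 t ht) (hLpos t).ne').deriv
    have h' : deriv Rbar t = deriv (A / L) t := congrArg (deriv · t) hRfun
    rw [h', h, hL2 t ht]
    have := pi_ne_zero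
    field_simp
    ring
  have hnonneg : ∀ t θ, 0 ≤ (R θ t - Rbar t) ^ 2 * (u θ t ^ 2)⁻¹ := fun t θ => by positivity
  refine ⟨hderiv, ?_, ?_⟩
  · refine monotoneOn_of_deriv_nonneg (convex_Ici 0)
      (fun t _ => (hRdiff t).continuousAt.continuousWithinAt)
      (fun t _ => (hRdiff t).differentiableWithinAt) fun t ht => ?_
    rw [hderiv t (interior_subset ht)]
    exact mul_nonneg (by positivity)
      (intervalIntegral.integral_nonneg two_pi_pos.le fun θ _ => hnonneg t θ)
  · intro t ht hconst
    rw [hderiv t ht]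
    refine mul_pos (by positivity) (intervalIntegral.integral_pos two_pi_pos
      (((hRc t).sub continuous_const).pow 2 |>.mul (hWtc t)).continuousOn
      (fun θ _ => hnonneg t θ) ?_)
    by_contra! hall
    refine hconst ⟨Rbar t, fun θ => ?_⟩
    have hper : Function.Periodic (fun θ => R θ t) (2 * π) := fun θ => by
      simp only [hR', hUper, hQ, partialFst_periodic (partialFst_periodic hUper)]
    obtain ⟨x, hx, hxθ⟩ := hper.exists_mem_Ico₀ two_pi_pos θ
    have h0 := le_antisymm (hall x (Set.Ico_subset_Icc_self hx)) (hnonneg t x)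
    have hw : (u x t ^ 2)⁻¹ ≠ 0 := inv_ne_zero (pow_ne_zero 2 (hupos x t).ne')
    have h1 := pow_eq_zero_iff two_ne_zero |>.1 ((mul_eq_zero.1 h0).resolve_right hw)
    exact hxθ.trans (sub_eq_zero.1 h1)
end

section
/- Let u : ℝ → ℝ be a continuously differentiable 2π-periodic function with u(θ) > 0 for all θ, and suppose that ∫_0^{2π} cos(θ+γ)·u(θ)^{−3} dθ = 0 for every γ ∈ ℝ (equivalently, ∫_0^{2π} u^{−3} cos θ dθ = ∫_0^{2π} u^{−3} sin θ dθ = 0). Then ( ∫_0^{2π} ( u'(θ)² − u(θ)² ) dθ ) · ( ∫_0^{2π} u(θ)^{−2} dθ ) ≥ −4π², with equality if and only if u(θ) = c·√( λ²·cos²(θ−α) + λ^{−2}·sin²(θ−α) ) for some constants c > 0, λ > 0 and α ∈ [0, 2π). -/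
open Real MeasureTheory

/-- If `f` and `sin` both vanish at `x₀`, then `f² cot` (which takes the value `0` at `x₀`) is
continuous there. -/
lemma continuousAt_sq_mul_cos_div_sin {f : ℝ → ℝ} {d x₀ : ℝ} (hf : HasDerivAt f d x₀)
    (h0 : f x₀ = 0) (hs : sin x₀ = 0) :
    ContinuousAt (fun x => f x ^ 2 * cos x / sin x) x₀ := by
  have hcos : cos x₀ ≠ 0 := by
    intro h
    have := sin_sq_add_cos_sq x₀
    simp [hs, h] at this
  rw [continuousAt_iff_punctured_nhds]
  have h1 := (hasDerivAt_iff_tendsto_slope.1 hf).div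
    (hasDerivAt_iff_tendsto_slope.1 (hasDerivAt_sin x₀)) hcos
  have h2 : Filter.Tendsto (fun x => f x * cos x) (nhdsWithin x₀ {x₀}ᶜ) (nhds (f x₀ * cos x₀)) :=
    (hf.continuousAt.mul continuous_cos.continuousAt).tendsto.mono_left nhdsWithin_le_nhds
  have h3 := h2.mul h1
  have e : f x₀ ^ 2 * cos x₀ / sin x₀ = f x₀ * cos x₀ * (d / cos x₀) := by simp [h0]
  rw [e]
  refine h3.congr' ?_
  filter_upwards [self_mem_nhdsWithin] with x hx
  have hx' : x - x₀ ≠ 0 := sub_ne_zero.2 hx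
  simp only [Pi.div_apply, slope_def_field, h0, hs, sub_zero]
  rw [div_div_div_cancel_right₀ hx']
  ring

/-- Wirtinger's inequality on `[0, π]` with Dirichlet boundary conditions, with its equality
case. -/
lemma wirtinger_dirichlet {f f' : ℝ → ℝ} (hf : ∀ x, HasDerivAt f (f' x) x) (hf' : Continuous f')
    (h0 : f 0 = 0) (hπ : f π = 0) :
    0 ≤ ∫ x in (0 : ℝ)..π, (f' x ^ 2 - f x ^ 2) ∧
      ((∫ x in (0 : ℝ)..π, (f' x ^ 2 - f x ^ 2)) = 0 →
        ∃ C, ∀ x ∈ Set.Icc 0 π, f x = C * sin x) := by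
  have hfc : Continuous f := continuous_iff_continuousAt.2 fun x => (hf x).continuousAt
  have hgc : Continuous fun x => f' x ^ 2 - f x ^ 2 := by fun_prop
  set F : ℝ → ℝ := fun x => (∫ y in (0 : ℝ)..x, (f' y ^ 2 - f y ^ 2)) - f x ^ 2 * cos x / sin x
    with hF
  have hF0 : F 0 = 0 := by simp [hF]
  have hFπ : F π = ∫ y in (0 : ℝ)..π, (f' y ^ 2 - f y ^ 2) := by simp [hF]
  have hsin : ∀ x ∈ Set.Ioo (0 : ℝ) π, sin x ≠ 0 := fun x hx => (sin_pos_of_mem_Ioo hx).ne'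
  have hder : ∀ x ∈ Set.Ioo (0 : ℝ) π,
      HasDerivAt F ((f' x - f x * cos x / sin x) ^ 2) x := by
    intro x hx
    have hs := hsin x hx
    have h1 := (hgc.integral_hasStrictDerivAt 0 x).hasDerivAt
    have h2 := ((((hf x).pow 2).mul (hasDerivAt_cos x)).div (hasDerivAt_sin x) hs)
    refine (h1.sub h2).congr_deriv ?_
    simp only [Pi.mul_apply, Pi.pow_apply]
    field_simp
    push_cast
    ring
  have hcont : ContinuousOn F (Set.Icc 0 π) := by
    intro x hx
    refine ContinuousAt.continuousWithinAt ?_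
    by_cases hx' : x ∈ Set.Ioo (0 : ℝ) π
    · exact (hder x hx').continuousAt
    have hx0 : f x = 0 ∧ sin x = 0 := by
      rcases eq_or_lt_of_le hx.1 with h | h
      · simp [← h, h0]
      · have : x = π := le_antisymm hx.2 (not_lt.1 fun h' => hx' ⟨h, h'⟩)
        simp [this, hπ]
    exact ((hgc.integral_hasStrictDerivAt 0 x).hasDerivAt.continuousAt).sub
      (continuousAt_sq_mul_cos_div_sin (hf x) hx0.1 hx0.2)
  have hmono : MonotoneOn F (Set.Icc 0 π) := by
    refine monotoneOn_of_deriv_nonneg (convex_Icc _ _) hcont ?_ ?_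
    · rw [interior_Icc]
      exact fun x hx => (hder x hx).differentiableAt.differentiableWithinAt
    · rw [interior_Icc]
      intro x hx
      rw [(hder x hx).deriv]
      positivity
  have h0m : (0 : ℝ) ∈ Set.Icc 0 π := ⟨le_rfl, pi_pos.le⟩
  have hπm : π ∈ Set.Icc 0 π := ⟨pi_pos.le, le_rfl⟩
  refine ⟨?_, fun hQ => ?_⟩
  · rw [← hFπ, ← hF0]
    exact hmono h0m hπm pi_pos.le
  have hFzero : ∀ x ∈ Set.Icc 0 π, F x = 0 := fun x hx =>
    le_antisymm (by simpa [hFπ, hQ] using hmono hx hπm hx.2)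
      (by simpa [hF0] using hmono h0m hx hx.1)
  have hode : ∀ x ∈ Set.Ioo (0 : ℝ) π, f' x = f x * cos x / sin x := by
    intro x hx
    have h1 : HasDerivAt F 0 x := (hasDerivAt_const x (0 : ℝ)).congr_of_eventuallyEq <| by
      filter_upwards [Icc_mem_nhds hx.1 hx.2] with y hy using hFzero y hy
    exact sub_eq_zero.1 (pow_eq_zero_iff two_ne_zero |>.1 ((hder x hx).unique h1))
  have hconst : ∀ x ∈ Set.Ioo (0 : ℝ) π, f x / sin x = f (π / 2) / sin (π / 2) := by
    intro x hx
    have hd : ∀ y ∈ Set.Ioo (0 : ℝ) π, HasDerivAt (fun y => f y / sin y) 0 y := by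
      intro y hy
      have hs := hsin y hy
      refine ((hf y).div (hasDerivAt_sin y) hs).congr_deriv ?_
      rw [hode y hy]
      field_simp
      ring
    refine isOpen_Ioo.is_const_of_deriv_eq_zero isPreconnected_Ioo
      (fun y hy => (hd y hy).differentiableAt.differentiableWithinAt)
      (fun y hy => (hd y hy).deriv) hx ⟨by linarith [pi_pos], by linarith [pi_pos]⟩
  refine ⟨f (π / 2) / sin (π / 2), fun x hx => ?_⟩
  by_cases hx' : x ∈ Set.Ioo (0 : ℝ) π
  · have hs := hsin x hx'
    rw [← hconst x hx']
    field_simp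
  · rcases eq_or_lt_of_le hx.1 with h | h
    · simp [← h, h0]
    · have : x = π := le_antisymm hx.2 (not_lt.1 fun h' => hx' ⟨h, h'⟩)
      simp [this, hπ]

/-- The Wirtinger inequality on `[0, 2π]` for functions vanishing at `0`, `π` and `2π`. -/
lemma wirtinger_dirichlet_two {f f' : ℝ → ℝ} (hf : ∀ x, HasDerivAt f (f' x) x)
    (hf' : Continuous f') (h0 : f 0 = 0) (hπ : f π = 0) (h2π : f (2 * π) = 0) :
    0 ≤ ∫ x in (0 : ℝ)..(2 * π), (f' x ^ 2 - f x ^ 2) ∧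
      ((∫ x in (0 : ℝ)..(2 * π), (f' x ^ 2 - f x ^ 2)) = 0 →
        ∃ C, ∀ x ∈ Set.Icc 0 (2 * π), f x = C * sin x) := by
  have hfc : Continuous f := continuous_iff_continuousAt.2 fun x => (hf x).continuousAt
  have hgc : Continuous fun x => f' x ^ 2 - f x ^ 2 := by fun_prop
  have hg : ∀ x, HasDerivAt (fun x => f (x + π)) (f' (x + π)) x := fun x =>
    HasDerivAt.comp_add_const x π (hf (x + π))
  obtain ⟨n1, e1⟩ := wirtinger_dirichlet hf hf' h0 hπ
  obtain ⟨n2, e2⟩ := wirtinger_dirichlet hg (by fun_prop) (by simpa using hπ)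
    (by rw [← two_mul]; exact h2π)
  have hsh : ∫ x in (0 : ℝ)..π, (f' (x + π) ^ 2 - f (x + π) ^ 2) =
      ∫ x in π..(2 * π), (f' x ^ 2 - f x ^ 2) := by
    rw [intervalIntegral.integral_comp_add_right (fun x => f' x ^ 2 - f x ^ 2) π]
    congr 1 <;> ring
  rw [hsh] at n2 e2
  rw [← intervalIntegral.integral_add_adjacent_intervals (hgc.intervalIntegrable 0 π)
    (hgc.intervalIntegrable π (2 * π))]
  refine ⟨by linarith, fun hQ => ?_⟩
  obtain ⟨C, hC⟩ := e1 (by linarith)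
  obtain ⟨D, hD⟩ := e2 (by linarith)
  have hπ0 := pi_pos
  have hD' : ∀ x ∈ Set.Icc π (2 * π), f x = -D * sin x := by
    intro x hx
    have := hD (x - π) ⟨by linarith [hx.1], by linarith [hx.2]⟩
    simp only [sub_add_cancel, sin_sub_pi] at this
    rw [this]
    ring
  have key : ∀ {E : ℝ} {s : Set ℝ}, UniqueDiffWithinAt ℝ s π → π ∈ s →
      (∀ x ∈ s, f x = E * sin x) → f' π = -E := by
    intro E s hs hmem hE
    have h1 : HasDerivWithinAt (fun x => E * sin x) (f' π) s π :=
      (hf π).hasDerivWithinAt.congr (fun x hx => (hE x hx).symm) (hE π hmem).symm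
    have h2 := ((hasDerivAt_sin π).const_mul E).hasDerivWithinAt (s := s)
    have := hs.eq_deriv s h1 h2
    simpa using this
  have k1 := key (uniqueDiffOn_Icc hπ0 π ⟨hπ0.le, le_rfl⟩) ⟨hπ0.le, le_rfl⟩ hC
  have k2 := key (uniqueDiffOn_Icc (by linarith : π < 2 * π) π ⟨le_rfl, by linarith⟩)
    ⟨le_rfl, by linarith⟩ hD'
  refine ⟨C, fun x hx => ?_⟩
  rcases le_total x π with h | h
  · exact hC x ⟨hx.1, h⟩
  · rw [hD' x ⟨h, hx.2⟩]
    congr 1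
    linarith

/-- A periodic solution of `G'' + G = w` for a positive weight `w` orthogonal to the first
harmonics: it is the support function of a convex body with curvature radius `w`. -/
lemma exists_support_function {w : ℝ → ℝ} (hw : Continuous w) (hpos : ∀ x, 0 < w x)
    (hcos : ∫ x in (0 : ℝ)..(2 * π), cos x * w x = 0)
    (hsin : ∫ x in (0 : ℝ)..(2 * π), sin x * w x = 0) :
    ∃ G G' : ℝ → ℝ, (∀ x, HasDerivAt G (G' x) x) ∧ (∀ x, HasDerivAt G' (w x - G x) x) ∧
      G 0 = 0 ∧ G (2 * π) = 0 ∧ G' 0 = 0 ∧ G' (2 * π) = 0 ∧ 0 < G π ∧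
      0 < ∫ x in (0 : ℝ)..(2 * π), G x * w x := by
  have cc : Continuous fun x => cos x * w x := by fun_prop
  have cs : Continuous fun x => sin x * w x := by fun_prop
  set A : ℝ → ℝ := fun x => ∫ y in (0 : ℝ)..x, cos y * w y with hA
  set B : ℝ → ℝ := fun x => ∫ y in (0 : ℝ)..x, sin y * w y with hB
  have dA : ∀ x, HasDerivAt A (cos x * w x) x := fun x =>
    (cc.integral_hasStrictDerivAt 0 x).hasDerivAt
  have dB : ∀ x, HasDerivAt B (sin x * w x) x := fun x =>
    (cs.integral_hasStrictDerivAt 0 x).hasDerivAt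
  have A0 : A 0 = 0 := by simp [hA]
  have B0 : B 0 = 0 := by simp [hB]
  have A2 : A (2 * π) = 0 := hcos
  have B2 : B (2 * π) = 0 := hsin
  set G : ℝ → ℝ := fun x => sin x * A x - cos x * B x with hG
  set G' : ℝ → ℝ := fun x => cos x * A x + sin x * B x with hG'
  have dG : ∀ x, HasDerivAt G (G' x) x := fun x => by
    refine (((hasDerivAt_sin x).mul (dA x)).sub ((hasDerivAt_cos x).mul (dB x))).congr_deriv ?_
    simp only [hG']
    ring
  have dG' : ∀ x, HasDerivAt G' (w x - G x) x := fun x => by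
    refine (((hasDerivAt_cos x).mul (dA x)).add ((hasDerivAt_sin x).mul (dB x))).congr_deriv ?_
    simp only [hG]
    linear_combination w x * sin_sq_add_cos_sq x
  have hGc : Continuous G := continuous_iff_continuousAt.2 fun x => (dG x).continuousAt
  have G_eq : ∀ x, G x = ∫ y in (0 : ℝ)..x, sin (x - y) * w y := by
    intro x
    simp only [hG, hA, hB]
    rw [← intervalIntegral.integral_const_mul, ← intervalIntegral.integral_const_mul,
      ← intervalIntegral.integral_sub (by apply Continuous.intervalIntegrable; fun_prop)
        (by apply Continuous.intervalIntegrable; fun_prop)]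
    congr 1
    ext y
    rw [sin_sub]
    ring
  have G_eq' : ∀ x, G x = ∫ y in x..(2 * π), sin (y - x) * w y := by
    intro x
    have hc : Continuous fun y => sin (x - y) * w y := by fun_prop
    have h0 : ∫ y in (0 : ℝ)..(2 * π), sin (x - y) * w y = 0 := by
      have : ∀ y, sin (x - y) * w y = sin x * (cos y * w y) - cos x * (sin y * w y) := by
        intro y
        rw [sin_sub]
        ring
      simp only [this]
      rw [intervalIntegral.integral_sub (by apply Continuous.intervalIntegrable; fun_prop)
        (by apply Continuous.intervalIntegrable; fun_prop), intervalIntegral.integral_const_mul,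
        intervalIntegral.integral_const_mul, hcos, hsin]
      simp
    rw [← intervalIntegral.integral_add_adjacent_intervals (hc.intervalIntegrable 0 x)
      (hc.intervalIntegrable x (2 * π)), ← G_eq] at h0
    have h1 : ∫ y in x..(2 * π), sin (y - x) * w y = -∫ y in x..(2 * π), sin (x - y) * w y := by
      rw [← intervalIntegral.integral_neg]
      congr 1
      ext y
      rw [← neg_sub x y, sin_neg]
      ring
    rw [h1]
    linarith
  have G_nonneg : ∀ x ∈ Set.Icc 0 (2 * π), 0 ≤ G x := by
    intro x hx
    rcases le_total x π with h | h
    · rw [G_eq]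
      refine intervalIntegral.integral_nonneg hx.1 fun y hy => mul_nonneg ?_ (hpos y).le
      exact sin_nonneg_of_nonneg_of_le_pi (by linarith [hy.2]) (by linarith [hy.1])
    · rw [G_eq']
      refine intervalIntegral.integral_nonneg hx.2 fun y hy => mul_nonneg ?_ (hpos y).le
      exact sin_nonneg_of_nonneg_of_le_pi (by linarith [hy.1]) (by linarith [hy.2])
  have Gπ : 0 < G π := by
    rw [G_eq]
    refine intervalIntegral.intervalIntegral_pos_of_pos_on
      (by apply Continuous.intervalIntegrable; fun_prop) (fun y hy => mul_pos ?_ (hpos y)) pi_pos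
    exact sin_pos_of_pos_of_lt_pi (by linarith [hy.2]) (by linarith [hy.1])
  refine ⟨G, G', dG, dG', by simp [hG, A0, B0], by simp [hG, A2, B2], by simp [hG', A0, B0],
    by simp [hG', A2, B2], Gπ, ?_⟩
  refine intervalIntegral.integral_pos (by linarith [pi_pos]) (by fun_prop)
    (fun x hx => mul_nonneg (G_nonneg x ⟨hx.1.le, hx.2⟩) (hpos x).le)
    ⟨π, ⟨pi_pos.le, by linarith [pi_pos]⟩, mul_pos Gπ (hpos π)⟩

/-- A planar Minkowski inequality: a periodic function orthogonal to a curvature radius `w`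
satisfies Wirtinger's inequality, with equality only for first harmonics. -/
lemma wirtinger_of_orthogonal_weight {w h h' : ℝ → ℝ} (hw : Continuous w) (hpos : ∀ x, 0 < w x)
    (hcos : ∫ x in (0 : ℝ)..(2 * π), cos x * w x = 0)
    (hsin : ∫ x in (0 : ℝ)..(2 * π), sin x * w x = 0)
    (hh : ∀ x, HasDerivAt h (h' x) x) (hh' : Continuous h') (hper : h (2 * π) = h 0)
    (horth : ∫ x in (0 : ℝ)..(2 * π), h x * w x = 0) :
    0 ≤ ∫ x in (0 : ℝ)..(2 * π), (h' x ^ 2 - h x ^ 2) ∧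
      ((∫ x in (0 : ℝ)..(2 * π), (h' x ^ 2 - h x ^ 2)) = 0 →
        ∃ a b, ∀ x ∈ Set.Icc 0 (2 * π), h x = a * cos x + b * sin x) := by
  obtain ⟨G, G', dG, dG', G0, G2, dG0, dG2, Gπ, hGw⟩ := exists_support_function hw hpos hcos hsin
  have hc : Continuous h := continuous_iff_continuousAt.2 fun x => (hh x).continuousAt
  have cG : Continuous G := continuous_iff_continuousAt.2 fun x => (dG x).continuousAt
  have cG' : Continuous G' := continuous_iff_continuousAt.2 fun x => (dG' x).continuousAt
  set l := (h 0 + h π) / G π with hl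
  have hlG : l * G π = h 0 + h π := by
    rw [hl]
    field_simp
  set f : ℝ → ℝ := fun x => h x - l * G x - h 0 * cos x with hf
  set f' : ℝ → ℝ := fun x => h' x - l * G' x + h 0 * sin x with hf'
  have df : ∀ x, HasDerivAt f (f' x) x := fun x => by
    refine (((hh x).sub ((dG x).const_mul l)).sub
      ((hasDerivAt_cos x).const_mul (h 0))).congr_deriv ?_
    simp only [hf']
    ring
  obtain ⟨hn, he⟩ := wirtinger_dirichlet_two df (by fun_prop) (by simp [hf, G0])
    (by simp only [hf, cos_pi]; linarith) (by simp [hf, G2, hper])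
  have hbd : ∫ x in (0 : ℝ)..(2 * π), ((f' x ^ 2 - f x ^ 2) - ((h' x ^ 2 - h x ^ 2) +
      (2 * l * (h x * w x) - l ^ 2 * (G x * w x)))) = 0 := by
    rw [intervalIntegral.integral_eq_sub_of_hasDerivAt (f := fun x =>
      -2 * l * (h x * G' x) + l ^ 2 * (G x * G' x) - h 0 ^ 2 * (sin x * cos x)
        + 2 * h 0 * (h x * sin x) - 2 * l * h 0 * (G x * sin x))]
    · simp [G0, G2, dG0, dG2]
    · intro x _
      refine ((((((hh x).mul (dG' x)).const_mul (-2 * l)).add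
        (((dG x).mul (dG' x)).const_mul (l ^ 2))).sub
        (((hasDerivAt_sin x).mul (hasDerivAt_cos x)).const_mul (h 0 ^ 2))).add
        (((hh x).mul (hasDerivAt_sin x)).const_mul (2 * h 0))).sub
        (((dG x).mul (hasDerivAt_sin x)).const_mul (2 * l * h 0)) |>.congr_deriv ?_
      simp only [hf, hf']
      ring
    · apply Continuous.intervalIntegrable
      fun_prop
  have hQ : ∫ x in (0 : ℝ)..(2 * π), (f' x ^ 2 - f x ^ 2) =
      (∫ x in (0 : ℝ)..(2 * π), (h' x ^ 2 - h x ^ 2)) -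
        l ^ 2 * ∫ x in (0 : ℝ)..(2 * π), G x * w x := by
    rw [intervalIntegral.integral_sub (by apply Continuous.intervalIntegrable; fun_prop)
      (by apply Continuous.intervalIntegrable; fun_prop),
      intervalIntegral.integral_add (by apply Continuous.intervalIntegrable; fun_prop)
      (by apply Continuous.intervalIntegrable; fun_prop),
      intervalIntegral.integral_sub (f := fun x => 2 * l * (h x * w x))
      (by apply Continuous.intervalIntegrable; fun_prop)
      (by apply Continuous.intervalIntegrable; fun_prop),
      intervalIntegral.integral_const_mul, intervalIntegral.integral_const_mul, horth] at hbd
    linarith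
  have hl2 : 0 ≤ l ^ 2 * ∫ x in (0 : ℝ)..(2 * π), G x * w x := by positivity
  refine ⟨by linarith, fun hz => ?_⟩
  have hl0 : l = 0 := by
    have : l ^ 2 * ∫ x in (0 : ℝ)..(2 * π), G x * w x = 0 := by linarith
    simpa [hGw.ne'] using this
  obtain ⟨C, hC⟩ := he (by rw [hQ, hz, hl0]; simp)
  refine ⟨h 0, C, fun x hx => ?_⟩
  have := hC x hx
  simp only [hf, hl0] at this
  linarith

/-- A positive function whose square is a quadratic form in `(cos, sin)` is a rotated
`SL(2)`-image of a constant. -/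
lemma exists_ellipse_of_sq_eq {u : ℝ → ℝ} (hpos : ∀ x, 0 < u x) {A B C : ℝ}
    (h : ∀ x, u x ^ 2 = A * cos x ^ 2 + 2 * B * (sin x * cos x) + C * sin x ^ 2) :
    ∃ c l a : ℝ, 0 < c ∧ 0 < l ∧ a ∈ Set.Ico (0 : ℝ) (2 * π) ∧
      ∀ x, u x = c * √(l ^ 2 * cos (x - a) ^ 2 + (l ^ 2)⁻¹ * sin (x - a) ^ 2) := by
  obtain ⟨R, φ, hφ, hR, hRc, hRs⟩ : ∃ R φ : ℝ, φ ∈ Set.Ico 0 (2 * π) ∧ 0 ≤ R ∧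
      (A - C) / 2 = R * cos (2 * φ) ∧ B = R * sin (2 * φ) := by
    let z : ℂ := ⟨(A - C) / 2, B⟩
    have hzc : (A - C) / 2 = ‖z‖ * cos z.arg := (Complex.norm_mul_cos_arg z).symm
    have hzs : B = ‖z‖ * sin z.arg := (Complex.norm_mul_sin_arg z).symm
    have h1 := Complex.neg_pi_lt_arg z
    have h2 := Complex.arg_le_pi z
    have hπ := pi_pos
    refine ⟨‖z‖, z.arg / 2 + π, ⟨by linarith, by linarith⟩, norm_nonneg _, ?_, ?_⟩
    · rw [show 2 * (z.arg / 2 + π) = z.arg + 2 * π by ring, cos_add_two_pi]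
      exact hzc
    · rw [show 2 * (z.arg / 2 + π) = z.arg + 2 * π by ring, sin_add_two_pi]
      exact hzs
  set p := (A + C) / 2 with hp
  have hu : ∀ x, u x ^ 2 = (p + R) * cos (x - φ) ^ 2 + (p - R) * sin (x - φ) ^ 2 := by
    intro x
    have e1 : cos (x - φ) ^ 2 = 1 / 2 + cos (2 * x - 2 * φ) / 2 := by
      rw [cos_sq]
      ring_nf
    have e2 : sin (x - φ) ^ 2 = 1 / 2 - cos (2 * x - 2 * φ) / 2 := by
      rw [sin_sq, e1]
      ring
    rw [e1, e2, cos_sub, h, cos_two_mul x, sin_two_mul x]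
    have h3 := sin_sq_add_cos_sq x
    linear_combination (C : ℝ) * h3 + (2 * cos x ^ 2 - 1) * hRc + 2 * sin x * cos x * hRs
  have hpR : 0 < p - R := by
    have := hu (φ + π / 2)
    simp only [add_sub_cancel_left, cos_pi_div_two, sin_pi_div_two] at this
    nlinarith [pow_pos (hpos (φ + π / 2)) 2]
  have hpR' : 0 < p + R := by linarith
  set c := √√((p + R) * (p - R)) with hc
  set l := √√((p + R) / (p - R)) with hl
  have hc2 : c ^ 2 = √(p + R) * √(p - R) := by
    rw [hc, sq_sqrt (sqrt_nonneg _), sqrt_mul hpR'.le]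
  have hl2 : l ^ 2 = √(p + R) / √(p - R) := by
    rw [hl, sq_sqrt (sqrt_nonneg _), sqrt_div hpR'.le]
  have hcpos : 0 < c := sqrt_pos.2 (sqrt_pos.2 (mul_pos hpR' hpR))
  have hlpos : 0 < l := sqrt_pos.2 (sqrt_pos.2 (div_pos hpR' hpR))
  refine ⟨c, l, φ, hcpos, hlpos, hφ, fun x => ?_⟩
  rw [← sqrt_sq (hpos x).le, ← sqrt_sq hcpos.le, ← sqrt_mul (sq_nonneg c), hu x]
  congr 1
  have s1 := sq_sqrt hpR'.le
  have s2 := sq_sqrt hpR.le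
  have p1 := sqrt_pos.2 hpR'
  have p2 := sqrt_pos.2 hpR
  rw [hc2, hl2]
  field_simp
  rw [s1, s2]
  ring

lemma mul_cos_sq_add_mul_sin_sq_pos {p q : ℝ} (hp : 0 < p) (hq : 0 < q) (x : ℝ) :
    0 < p * cos x ^ 2 + q * sin x ^ 2 := by
  rcases eq_or_ne (cos x) 0 with h | h
  · have : sin x ^ 2 = 1 := by simpa [h] using sin_sq_add_cos_sq x
    rw [this, h]
    positivity
  · positivity

/-- The area of the centred ellipse with semi-axes `l⁻¹` and `l`, in polar coordinates. -/
lemma integral_inv_ellipse {l : ℝ} (hl : 0 < l) (a : ℝ) :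
    ∫ x in (0 : ℝ)..(2 * π), (l ^ 2 * cos (x - a) ^ 2 + (l ^ 2)⁻¹ * sin (x - a) ^ 2)⁻¹ =
      2 * π := by
  have hD : ∀ y, 0 < l * cos y ^ 2 + l⁻¹ * sin y ^ 2 :=
    mul_cos_sq_add_mul_sin_sq_pos hl (inv_pos.2 hl)
  have hE : ∀ y, 0 < l ^ 2 * cos y ^ 2 + (l ^ 2)⁻¹ * sin y ^ 2 :=
    mul_cos_sq_add_mul_sin_sq_pos (by positivity) (by positivity)
  have hd : ∀ y, HasDerivAt (fun y => y + arctan ((l⁻¹ - l) * (sin y * cos y) /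
      (l * cos y ^ 2 + l⁻¹ * sin y ^ 2))) (l ^ 2 * cos y ^ 2 + (l ^ 2)⁻¹ * sin y ^ 2)⁻¹ y := by
    intro y
    have h1 := ((hasDerivAt_sin y).mul (hasDerivAt_cos y)).const_mul (l⁻¹ - l)
    have h2 := (((hasDerivAt_cos y).pow 2).const_mul l).add
      (((hasDerivAt_sin y).pow 2).const_mul l⁻¹)
    refine ((hasDerivAt_id y).add (h1.div h2 (hD y).ne').arctan).congr_deriv ?_
    have hDy := (hD y).ne'
    have hEy := (hE y).ne'
    have hcs := sin_sq_add_cos_sq y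
    have hlm : l * l⁻¹ = 1 := mul_inv_cancel₀ hl.ne'
    have hsum : (l * cos y ^ 2 + l⁻¹ * sin y ^ 2) ^ 2 + ((l⁻¹ - l) * (sin y * cos y)) ^ 2 =
        l ^ 2 * cos y ^ 2 + (l ^ 2)⁻¹ * sin y ^ 2 := by
      rw [← inv_pow]
      linear_combination (l ^ 2 * cos y ^ 2 + l⁻¹ ^ 2 * sin y ^ 2) * hcs
    have hnum : (l⁻¹ - l) * (cos y ^ 2 - sin y ^ 2) * (l * cos y ^ 2 + l⁻¹ * sin y ^ 2) -
        (l⁻¹ - l) * (sin y * cos y) * (2 * (l⁻¹ - l) * (sin y * cos y)) =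
        1 - (l ^ 2 * cos y ^ 2 + (l ^ 2)⁻¹ * sin y ^ 2) := by
      rw [← inv_pow]
      linear_combination ((l⁻¹ - l) * (l * cos y ^ 2 - l⁻¹ * sin y ^ 2) + 1) * hcs +
        (cos y ^ 2 + sin y ^ 2) * hlm
    have hval : ∀ N N' D D' E : ℝ, D ≠ 0 → E ≠ 0 → D ^ 2 + N ^ 2 = E → N' * D - N * D' = 1 - E →
        1 + 1 / (1 + (N / D) ^ 2) * ((N' * D - N * D') / D ^ 2) = E⁻¹ := by
      intro N N' D D' E hD hE h1 h2
      rw [h2, show 1 + (N / D) ^ 2 = E / D ^ 2 by rw [← h1]; field_simp]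
      field_simp
      ring
    rw [← hval _ _ _ _ _ hDy hEy hsum hnum]
    simp only [Pi.mul_apply, Pi.pow_apply, Pi.add_apply, Pi.div_apply]
    congr 4
    · ring
    · push_cast
      ring
  have hshift : ∀ x, HasDerivAt (fun x => (fun y => y + arctan ((l⁻¹ - l) * (sin y * cos y) /
      (l * cos y ^ 2 + l⁻¹ * sin y ^ 2))) (x - a))
      (l ^ 2 * cos (x - a) ^ 2 + (l ^ 2)⁻¹ * sin (x - a) ^ 2)⁻¹ x := fun x =>
    HasDerivAt.comp_sub_const x a (hd (x - a))
  rw [intervalIntegral.integral_eq_sub_of_hasDerivAt (fun x _ => hshift x)]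
  · simp only [show 2 * π - a = -a + 2 * π by ring, zero_sub, sin_add_two_pi, cos_add_two_pi]
    ring
  · refine (Continuous.inv₀ (by fun_prop) fun x => (hE (x - a)).ne').intervalIntegrable _ _

/-- Equality in the Blaschke–Santaló inequality for ellipses. -/
lemma blaschke_santalo_eq_of_ellipse {u : ℝ → ℝ} {c l a : ℝ} (hc : 0 < c) (hl : 0 < l)
    (hu : ∀ x, u x = c * √(l ^ 2 * cos (x - a) ^ 2 + (l ^ 2)⁻¹ * sin (x - a) ^ 2)) :
    ((∫ x in (0 : ℝ)..(2 * π), (deriv u x ^ 2 - u x ^ 2)) *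
      ∫ x in (0 : ℝ)..(2 * π), (u x ^ 2)⁻¹) = -(4 * π ^ 2) := by
  set D : ℝ → ℝ := fun x => l ^ 2 * cos (x - a) ^ 2 + (l ^ 2)⁻¹ * sin (x - a) ^ 2 with hD
  have hDpos : ∀ x, 0 < D x := fun x =>
    mul_cos_sq_add_mul_sin_sq_pos (by positivity) (by positivity) (x - a)
  have hDc : Continuous D := by fun_prop
  have hDi : Continuous fun x => (D x)⁻¹ := hDc.inv₀ fun x => (hDpos x).ne'
  have hint : ∫ x in (0 : ℝ)..(2 * π), (D x)⁻¹ = 2 * π := integral_inv_ellipse hl a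
  have hs : ∀ x, HasDerivAt (fun x => sin (x - a)) (cos (x - a)) x := fun x =>
    HasDerivAt.comp_sub_const x a (hasDerivAt_sin (x - a))
  have hco : ∀ x, HasDerivAt (fun x => cos (x - a)) (-sin (x - a)) x := fun x =>
    HasDerivAt.comp_sub_const x a (hasDerivAt_cos (x - a))
  have hDd : ∀ x, HasDerivAt D (-2 * (l ^ 2 - (l ^ 2)⁻¹) * (sin (x - a) * cos (x - a))) x := by
    intro x
    refine ((((hco x).pow 2).const_mul (l ^ 2)).add
      (((hs x).pow 2).const_mul (l ^ 2)⁻¹)).congr_deriv ?_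
    push_cast
    ring
  have hu2 : ∀ x, u x ^ 2 = c ^ 2 * D x := fun x => by
    rw [hu x, mul_pow, sq_sqrt (hDpos x).le]
  have hud : ∀ x, deriv u x ^ 2 =
      c ^ 2 * ((l ^ 2 - (l ^ 2)⁻¹) * (sin (x - a) * cos (x - a))) ^ 2 * (D x)⁻¹ := by
    intro x
    have h1 := ((hDd x).sqrt (hDpos x).ne').const_mul c
    rw [show u = fun x => c * √(D x) from funext hu, h1.deriv, mul_pow, div_pow, mul_pow 2 √(D x),
      sq_sqrt (hDpos x).le]
    have := (hDpos x).ne'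
    field_simp
  have hE : ∀ x, deriv u x ^ 2 - u x ^ 2 =
      -c ^ 2 * (D x)⁻¹ - c ^ 2 * (l ^ 2 - (l ^ 2)⁻¹) * (cos (x - a) ^ 2 - sin (x - a) ^ 2) := by
    intro x
    have h0 := (hDpos x).ne'
    have hcs := sin_sq_add_cos_sq (x - a)
    have hlm : l ^ 2 * (l ^ 2)⁻¹ = 1 := mul_inv_cancel₀ (by positivity)
    have key : ((l ^ 2 - (l ^ 2)⁻¹) * (sin (x - a) * cos (x - a))) ^ 2 - D x ^ 2 =
        -1 - (l ^ 2 - (l ^ 2)⁻¹) * (cos (x - a) ^ 2 - sin (x - a) ^ 2) * D x := by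
      simp only [hD]
      generalize cos (x - a) = C at *
      generalize sin (x - a) = S at *
      generalize (l ^ 2)⁻¹ = m at *
      linear_combination -(S ^ 2 + C ^ 2) ^ 2 * hlm - (S ^ 2 + C ^ 2 + 1) * hcs
    rw [hud, hu2]
    linear_combination c ^ 2 * (D x)⁻¹ * key + (c ^ 2 * D x - c ^ 2 * (l ^ 2 - (l ^ 2)⁻¹) *
      (cos (x - a) ^ 2 - sin (x - a) ^ 2)) * mul_inv_cancel₀ h0
  have hmid : ∫ x in (0 : ℝ)..(2 * π), (cos (x - a) ^ 2 - sin (x - a) ^ 2) = 0 := by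
    rw [intervalIntegral.integral_eq_sub_of_hasDerivAt
      (f := fun x => sin (x - a) * cos (x - a))]
    · simp only [show 2 * π - a = -a + 2 * π by ring, zero_sub, sin_add_two_pi, cos_add_two_pi]
      ring
    · intro x _
      refine ((hs x).mul (hco x)).congr_deriv ?_
      ring
    · apply Continuous.intervalIntegrable
      fun_prop
  simp only [hE]
  simp only [hu2, mul_inv]
  rw [intervalIntegral.integral_sub (by apply Continuous.intervalIntegrable; fun_prop)
    (by apply Continuous.intervalIntegrable; fun_prop), intervalIntegral.integral_const_mul,
    intervalIntegral.integral_const_mul, intervalIntegral.integral_const_mul, hint, hmid]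
  field_simp
  ring

/-- General Blaschke–Santaló inequality on the circle: for a positive C¹,
2π-periodic function u whose first Fourier coefficients of u⁻³ vanish,
`(∫ (u'² − u²))·(∫ u⁻²) ≥ −4π²`, with equality iff
`u(θ) = c√(λ²cos²(θ−α) + λ⁻²sin²(θ−α))`. -/
theorem blaschke_santalo
    (u : ℝ → ℝ)
    (hu : ContDiff ℝ 1 u)
    (huper : ∀ θ, u (θ + 2 * π) = u θ)
    (hupos : ∀ θ, 0 < u θ)
    (horth : ∀ γ : ℝ, ∫ θ in (0:ℝ)..(2 * π), Real.cos (θ + γ) * ((u θ) ^ 3)⁻¹ = 0) :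
    ((∫ θ in (0:ℝ)..(2 * π), ((deriv u θ) ^ 2 - (u θ) ^ 2)) *
        ∫ θ in (0:ℝ)..(2 * π), ((u θ) ^ 2)⁻¹) ≥ -(4 * π ^ 2)
    ∧ (((∫ θ in (0:ℝ)..(2 * π), ((deriv u θ) ^ 2 - (u θ) ^ 2)) *
          ∫ θ in (0:ℝ)..(2 * π), ((u θ) ^ 2)⁻¹) = -(4 * π ^ 2)
        ↔ ∃ (c l a : ℝ), 0 < c ∧ 0 < l ∧ a ∈ Set.Ico (0:ℝ) (2 * π) ∧
            ∀ θ, u θ = c * Real.sqrt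
              (l ^ 2 * (Real.cos (θ - a)) ^ 2 + (l ^ 2)⁻¹ * (Real.sin (θ - a)) ^ 2)) := by
  have hπ := pi_pos
  have uc : Continuous u := hu.continuous
  have uc' : Continuous (deriv u) := hu.continuous_deriv le_rfl
  have ud : ∀ x, HasDerivAt u (deriv u x) x := fun x =>
    (hu.differentiable one_ne_zero x).hasDerivAt
  have wc : Continuous fun x => (u x ^ 3)⁻¹ := (uc.pow 3).inv₀ fun x => (pow_pos (hupos x) 3).ne'
  have vc : Continuous fun x => (u x ^ 2)⁻¹ := (uc.pow 2).inv₀ fun x => (pow_pos (hupos x) 2).ne'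
  have wpos : ∀ x, 0 < (u x ^ 3)⁻¹ := fun x => inv_pos.2 (pow_pos (hupos x) 3)
  have hcos : ∫ x in (0 : ℝ)..(2 * π), cos x * (u x ^ 3)⁻¹ = 0 := by simpa using horth 0
  have hsin : ∫ x in (0 : ℝ)..(2 * π), sin x * (u x ^ 3)⁻¹ = 0 := by
    simpa [cos_add_pi_div_two] using horth (π / 2)
  set T := ∫ x in (0 : ℝ)..(2 * π), (u x ^ 2)⁻¹ with hT
  set E := ∫ x in (0 : ℝ)..(2 * π), (deriv u x ^ 2 - u x ^ 2) with hE
  have Tpos : 0 < T := intervalIntegral.intervalIntegral_pos_of_pos_on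
    (vc.intervalIntegrable _ _) (fun x _ => inv_pos.2 (pow_pos (hupos x) 2)) (by linarith)
  set k := 2 * π / T with hk
  have kpos : 0 < k := by positivity
  set t : ℝ → ℝ := fun x => k * ∫ y in (0 : ℝ)..x, (u y ^ 2)⁻¹ with ht
  have dt : ∀ x, HasDerivAt t (k * (u x ^ 2)⁻¹) x := fun x =>
    (vc.integral_hasStrictDerivAt 0 x).hasDerivAt.const_mul k
  have tc : Continuous t := continuous_iff_continuousAt.2 fun x => (dt x).continuousAt
  have t0 : t 0 = 0 := by simp [ht]
  have t2 : t (2 * π) = 2 * π := by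
    simp only [ht, hk, ← hT]
    field_simp
  have u2 : u (2 * π) = u 0 := by simpa using huper 0
  have key : ∀ s : ℝ, 0 ≤ ∫ x in (0 : ℝ)..(2 * π), ((deriv u x * cos (t x + s) -
        u x * (sin (t x + s) * (k * (u x ^ 2)⁻¹))) ^ 2 - (u x * cos (t x + s)) ^ 2) ∧
      ((∫ x in (0 : ℝ)..(2 * π), ((deriv u x * cos (t x + s) -
        u x * (sin (t x + s) * (k * (u x ^ 2)⁻¹))) ^ 2 - (u x * cos (t x + s)) ^ 2)) = 0 →
        ∃ a b, ∀ x ∈ Set.Icc 0 (2 * π), u x * cos (t x + s) = a * cos x + b * sin x) := by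
    intro s
    refine wirtinger_of_orthogonal_weight (h := fun x => u x * cos (t x + s)) wc wpos hcos hsin
      (fun x => ?_) (by fun_prop) ?_ ?_
    · refine ((ud x).mul ((dt x).add_const s).cos).congr_deriv ?_
      ring
    · rw [u2, t2, t0, zero_add, add_comm, cos_add_two_pi]
    · have e : ∀ x, u x * cos (t x + s) * (u x ^ 3)⁻¹ = cos (t x + s) * (u x ^ 2)⁻¹ := by
        intro x
        have := (hupos x).ne'
        field_simp
      simp only [e]
      rw [intervalIntegral.integral_eq_sub_of_hasDerivAt (f := fun x => sin (t x + s) / k)]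
      · rw [t2, t0, zero_add, add_comm, sin_add_two_pi]
        simp
      · intro x _
        refine (((dt x).add_const s).sin.div_const k).congr_deriv ?_
        field_simp
      · exact (by fun_prop : Continuous _).intervalIntegrable _ _
  obtain ⟨n1, e1⟩ := key 0
  obtain ⟨n2, e2⟩ := key (-(π / 2))
  simp only [add_zero, ← sub_eq_add_neg, cos_sub_pi_div_two, sin_sub_pi_div_two] at n1 e1 n2 e2
  have hsum : (∫ x in (0 : ℝ)..(2 * π), ((deriv u x * cos (t x) -
        u x * (sin (t x) * (k * (u x ^ 2)⁻¹))) ^ 2 - (u x * cos (t x)) ^ 2)) +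
      (∫ x in (0 : ℝ)..(2 * π), ((deriv u x * sin (t x) -
        u x * (-cos (t x) * (k * (u x ^ 2)⁻¹))) ^ 2 - (u x * sin (t x)) ^ 2)) =
      E + k ^ 2 * T := by
    rw [← intervalIntegral.integral_add (by apply Continuous.intervalIntegrable; fun_prop)
      (by apply Continuous.intervalIntegrable; fun_prop), hE, hT,
      ← intervalIntegral.integral_const_mul,
      ← intervalIntegral.integral_add (by apply Continuous.intervalIntegrable; fun_prop)
      (by apply Continuous.intervalIntegrable; fun_prop)]
    congr 1
    ext x
    have h0 := (hupos x).ne'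
    have hv : (u x * (u x ^ 2)⁻¹) ^ 2 = (u x ^ 2)⁻¹ := by field_simp
    linear_combination (deriv u x ^ 2 - u x ^ 2 + k ^ 2 * (u x * (u x ^ 2)⁻¹) ^ 2) *
      sin_sq_add_cos_sq (t x) + k ^ 2 * hv
  have hET : E * T + 4 * π ^ 2 = (E + k ^ 2 * T) * T := by
    rw [hk]
    field_simp
    ring
  have hEk : 0 ≤ E + k ^ 2 * T := by linarith
  refine ⟨by nlinarith [mul_nonneg hEk Tpos.le], fun heq => ?_, ?_⟩
  · have hz : E + k ^ 2 * T = 0 := by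
      have : (E + k ^ 2 * T) * T = 0 := by linarith
      exact (mul_eq_zero.1 this).resolve_right Tpos.ne'
    obtain ⟨a₁, b₁, h₁⟩ := e1 (by linarith)
    obtain ⟨a₂, b₂, h₂⟩ := e2 (by linarith)
    refine exists_ellipse_of_sq_eq (A := a₁ ^ 2 + a₂ ^ 2) (B := a₁ * b₁ + a₂ * b₂)
      (C := b₁ ^ 2 + b₂ ^ 2) hupos fun x => ?_
    have hper : Function.Periodic (fun x => u x ^ 2 - ((a₁ ^ 2 + a₂ ^ 2) * cos x ^ 2 +
        2 * (a₁ * b₁ + a₂ * b₂) * (sin x * cos x) + (b₁ ^ 2 + b₂ ^ 2) * sin x ^ 2)) (2 * π) := by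
      intro x
      simp only [huper, cos_add_two_pi, sin_add_two_pi]
    obtain ⟨y, hy, hxy⟩ := hper.exists_mem_Ico₀ (by linarith) x
    rw [← sub_eq_zero, hxy]
    have g₁ := h₁ y ⟨hy.1, hy.2.le⟩
    have g₂ := h₂ y ⟨hy.1, hy.2.le⟩
    linear_combination (u y * cos (t y) + a₁ * cos y + b₁ * sin y) * g₁ +
      (u y * sin (t y) + a₂ * cos y + b₂ * sin y) * g₂ - u y ^ 2 * sin_sq_add_cos_sq (t y)
  · rintro ⟨c, l, a, hc, hl, -, h⟩
    exact blaschke_santalo_eq_of_ellipse hc hl h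
end

section
/- Let u : ℝ → ℝ be a smooth 2π-periodic function with u(θ) > 0 for all θ and with ∫_0^{2π} u(θ)^{−2} dθ = 2π. Define the 4-scalar curvature R(θ) = u(θ)³·(4u''(θ) + u(θ)) and its average R̄ = (1/(2π))·∫_0^{2π} R(θ)·u(θ)^{−2} dθ. Then R̄ ≤ 1; equivalently, ∫_0^{2π} ( u(θ)² − 4u'(θ)² ) dθ ≤ 2π. -/
open Real MeasureTheory

/-- If `f` and `g` vanish at `a` and `g` has nonzero derivative there, then `f² c / g`
(with value `0` at `a`) is continuous at `a`. -/
theorem continuousAt_sq_mul_div_of_hasDerivAt {f g c : ℝ → ℝ} {f' g' a : ℝ}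
    (hf : HasDerivAt f f' a) (hg : HasDerivAt g g' a) (hc : ContinuousAt c a)
    (hfa : f a = 0) (hga : g a = 0) (hg' : g' ≠ 0) :
    ContinuousAt (fun x => f x ^ 2 * c x / g x) a := by
  rw [continuousAt_iff_punctured_nhds]
  have h1 := (hf.tendsto_slope.div hg.tendsto_slope hg').mul
    ((hf.continuousAt.mul hc).tendsto.mono_left nhdsWithin_le_nhds)
  rw [Pi.mul_apply, hfa, zero_mul, mul_zero] at h1
  simp only [hfa, hga, div_zero]
  refine h1.congr' ?_
  filter_upwards [self_mem_nhdsWithin] with x hx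
  have hxa : x - a ≠ 0 := sub_ne_zero.mpr hx
  simp only [Pi.div_apply, Pi.mul_apply, slope_def_field, hfa, hga, sub_zero]
  rw [div_div_div_cancel_right₀ hxa]
  ring

/-- Wirtinger's inequality for functions vanishing at both ends of an interval of
length `2π`. -/
theorem integral_four_deriv_sq_sub_sq_nonneg {h h' : ℝ → ℝ} {b : ℝ}
    (hh : ∀ x, HasDerivAt h (h' x) x) (hc : Continuous h')
    (h0 : h b = 0) (h1 : h (b + 2 * π) = 0) :
    0 ≤ ∫ x in b..(b + 2 * π), (4 * h' x ^ 2 - h x ^ 2) := by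
  have hcont : Continuous h := continuous_iff_continuousAt.mpr fun x => (hh x).continuousAt
  have hint : Continuous fun x => 4 * h' x ^ 2 - h x ^ 2 := by fun_prop
  have hlin : ∀ x, HasDerivAt (fun x => (x - b) / 2) (1 / 2) x := fun x =>
    ((hasDerivAt_id x).sub_const b).div_const 2
  have hsin : ∀ x, HasDerivAt (fun x => sin ((x - b) / 2)) (cos ((x - b) / 2) * (1 / 2)) x :=
    fun x => (hlin x).sin
  have hcos : ∀ x, HasDerivAt (fun x => cos ((x - b) / 2)) (-sin ((x - b) / 2) * (1 / 2)) x :=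
    fun x => (hlin x).cos
  have hpos : ∀ x ∈ Set.Ioo b (b + 2 * π), 0 < sin ((x - b) / 2) := fun x hx =>
    sin_pos_of_pos_of_lt_pi (by linarith [hx.1]) (by linarith [hx.2])
  have hend : (b + 2 * π - b) / 2 = π := by ring
  set F : ℝ → ℝ := fun x => h x ^ 2 * cos ((x - b) / 2) / sin ((x - b) / 2) with hF
  have hFd : ∀ x ∈ Set.Ioo b (b + 2 * π), HasDerivAt F
      ((((2 * h x * h' x) * cos ((x - b) / 2) + h x ^ 2 * (-sin ((x - b) / 2) * (1 / 2)))
        * sin ((x - b) / 2) - h x ^ 2 * cos ((x - b) / 2) * (cos ((x - b) / 2) * (1 / 2)))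
        / sin ((x - b) / 2) ^ 2) x := fun x hx => by
    have hsq : HasDerivAt (fun x => h x ^ 2) (2 * h x * h' x) x := by
      simpa using (hh x).fun_pow 2
    exact (hsq.mul (hcos x)).div (hsin x) (hpos x hx).ne'
  have hFc : ∀ x ∈ Set.Icc b (b + 2 * π), ContinuousAt F x := by
    intro x hx
    rcases eq_or_lt_of_le hx.1 with rfl | hbx
    · exact continuousAt_sq_mul_div_of_hasDerivAt (hh _) (hsin _) (hcos _).continuousAt h0
        (by simp) (by simp)
    rcases eq_or_lt_of_le hx.2 with rfl | hxb
    · exact continuousAt_sq_mul_div_of_hasDerivAt (hh _) (hsin _) (hcos _).continuousAt h1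
        (by rw [hend, sin_pi]) (by rw [hend, cos_pi]; norm_num)
    · exact (hFd x ⟨hbx, hxb⟩).continuousAt
  have hId : ∀ x, HasDerivAt (fun x => ∫ t in b..x, (4 * h' t ^ 2 - h t ^ 2))
      (4 * h' x ^ 2 - h x ^ 2) x := fun x => hint.integral_hasStrictDerivAt b x |>.hasDerivAt
  have hmono : MonotoneOn (fun x => (∫ t in b..x, (4 * h' t ^ 2 - h t ^ 2)) - 2 * F x)
      (Set.Icc b (b + 2 * π)) := by
    refine monotoneOn_of_deriv_nonneg (convex_Icc _ _) ?_ ?_ ?_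
    · exact fun x hx => ((hId x).continuousAt.sub
        (continuousAt_const.mul (hFc x hx))).continuousWithinAt
    · rw [interior_Icc]
      exact fun x hx => ((hId x).sub
        ((hFd x hx).const_mul 2)).differentiableAt.differentiableWithinAt
    · rw [interior_Icc]
      intro x hx
      rw [((hId x).fun_sub ((hFd x hx).const_mul 2)).deriv]
      have hs := (hpos x hx).ne'
      have hsc := sin_sq_add_cos_sq ((x - b) / 2)
      generalize sin ((x - b) / 2) = s at hs hsc ⊢
      generalize cos ((x - b) / 2) = c at hsc ⊢
      have key : (2 * h' x - h x * (c / s)) ^ 2 = 4 * h' x ^ 2 - h x ^ 2 -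
          2 * (((2 * h x * h' x * c + h x ^ 2 * (-s * (1 / 2))) * s -
            h x ^ 2 * c * (c * (1 / 2))) / s ^ 2) := by
        field_simp
        ring
      rw [← key]
      positivity
  have hb : b ≤ b + 2 * π := by linarith [pi_pos]
  have hle := hmono (Set.left_mem_Icc.mpr hb) (Set.right_mem_Icc.mpr hb) hb
  simpa [hF, h0, h1] using hle

/-- Wirtinger's inequality for `u sin ((s - s b) / 2)`, where `s' = u⁻²` and `s` advances
by `2π` over a period of `u`. -/
theorem integral_phase_nonneg {u u' s : ℝ → ℝ}
    (hu : ∀ x, HasDerivAt u (u' x) x) (hu' : Continuous u')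
    (hpos : ∀ x, 0 < u x) (hper : ∀ x, u (x + 2 * π) = u x)
    (hper' : ∀ x, u' (x + 2 * π) = u' x)
    (hs : ∀ x, HasDerivAt s ((u x ^ 2)⁻¹) x) (hsper : ∀ x, s (x + 2 * π) = s x + 2 * π)
    (b : ℝ) :
    0 ≤ ∫ x in (0 : ℝ)..(2 * π),
      (4 * (u' x * sin ((s x - s b) / 2) + cos ((s x - s b) / 2) / (2 * u x)) ^ 2
        - (u x * sin ((s x - s b) / 2)) ^ 2) := by
  have hcu : Continuous u := continuous_iff_continuousAt.mpr fun x => (hu x).continuousAt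
  have hcs : Continuous s := continuous_iff_continuousAt.mpr fun x => (hs x).continuousAt
  have hshift : ∀ x, (s (x + 2 * π) - s b) / 2 = (s x - s b) / 2 + π := fun x => by
    rw [hsper]; ring
  have hd : ∀ x, HasDerivAt (fun x => u x * sin ((s x - s b) / 2))
      (u' x * sin ((s x - s b) / 2) + cos ((s x - s b) / 2) / (2 * u x)) x := fun x => by
    have hphase : HasDerivAt (fun x => (s x - s b) / 2) ((u x ^ 2)⁻¹ / 2) x :=
      ((hs x).sub_const (s b)).div_const 2
    refine ((hu x).fun_mul hphase.sin).congr_deriv ?_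
    have := (hpos x).ne'
    field_simp
  have hw := integral_four_deriv_sq_sub_sq_nonneg (b := b) hd
    ((hu'.mul (by fun_prop)).add (Continuous.div (by fun_prop) (by fun_prop)
      fun x => by have := hpos x; positivity))
    (by simp) (by simp [hshift])
  have hp : Function.Periodic (fun x =>
      4 * (u' x * sin ((s x - s b) / 2) + cos ((s x - s b) / 2) / (2 * u x)) ^ 2
        - (u x * sin ((s x - s b) / 2)) ^ 2) (2 * π) := fun x => by
    simp only [hshift, hper, hper', sin_add_pi, cos_add_pi]
    ring
  simpa using hw.trans_eq (hp.intervalIntegral_add_eq b 0)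

/-- For a smooth positive 2π-periodic u with `∫ u⁻² dθ = 2π`, the average
4-scalar curvature `R̄ = (1/2π)∫ u³(4u''+u)·u⁻² dθ` satisfies `R̄ ≤ 1`;
equivalently `∫ (u² − 4u'²) dθ ≤ 2π`. -/
theorem average_four_curvature_le_one
    (u : ℝ → ℝ)
    (hu : ContDiff ℝ (⊤ : ℕ∞) u)
    (huper : ∀ θ, u (θ + 2 * π) = u θ)
    (hupos : ∀ θ, 0 < u θ)
    (hnorm : ∫ θ in (0:ℝ)..(2 * π), ((u θ) ^ 2)⁻¹ = 2 * π) :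
    (1 / (2 * π)) *
        (∫ θ in (0:ℝ)..(2 * π),
          ((u θ) ^ 3 * (4 * deriv (deriv u) θ + u θ)) * ((u θ) ^ 2)⁻¹) ≤ 1
    ∧ (∫ θ in (0:ℝ)..(2 * π), ((u θ) ^ 2 - 4 * (deriv u θ) ^ 2)) ≤ 2 * π := by
  have hu1 : ∀ x, HasDerivAt u (deriv u x) x := fun x =>
    (hu.differentiable (by simp) x).hasDerivAt
  have hdu : ContDiff ℝ (⊤ : ℕ∞) (deriv u) := (contDiff_infty_iff_deriv.mp hu).2
  have hu2 : ∀ x, HasDerivAt (deriv u) (deriv (deriv u) x) x := fun x =>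
    (hdu.differentiable (by simp) x).hasDerivAt
  have hcu : Continuous u := hu.continuous
  have hcu' : Continuous (deriv u) := hdu.continuous
  have hcu'' : Continuous (deriv (deriv u)) := (contDiff_infty_iff_deriv.mp hdu).2.continuous
  have hper' : ∀ x, deriv u (x + 2 * π) = deriv u x := fun x => by
    rw [← deriv_comp_add_const, funext huper]
  have hci : Continuous fun x => (u x ^ 2)⁻¹ :=
    (hcu.pow 2).inv₀ fun x => (pow_pos (hupos x) 2).ne'
  set s : ℝ → ℝ := fun x => ∫ t in (0 : ℝ)..x, (u t ^ 2)⁻¹ with hsdef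
  have hs : ∀ x, HasDerivAt s ((u x ^ 2)⁻¹) x := fun x =>
    (hci.integral_hasStrictDerivAt 0 x).hasDerivAt
  have hcs : Continuous s := continuous_iff_continuousAt.mpr fun x => (hs x).continuousAt
  have hs0 : s 0 = 0 := intervalIntegral.integral_same
  have hsper : ∀ x, s (x + 2 * π) = s x + 2 * π := fun x => by
    have hp : Function.Periodic (fun x => (u x ^ 2)⁻¹) (2 * π) := fun x => by
      simp only [huper]
    have h1 := hp.intervalIntegral_add_eq x 0
    rw [zero_add, hnorm] at h1
    simp only [hsdef]
    rw [← intervalIntegral.integral_add_adjacent_intervals (b := x)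
      (hci.intervalIntegrable _ _) (hci.intervalIntegrable _ _), h1]
  obtain ⟨b, -, hb⟩ : π ∈ s '' Set.Icc 0 (2 * π) := by
    refine intermediate_value_Icc (by positivity) hcs.continuousOn ⟨?_, ?_⟩
    · rw [hs0]; positivity
    · have h2 : s (2 * π) = 2 * π := hnorm
      rw [h2]; linarith [pi_pos]
  have hphase := integral_phase_nonneg hu1 hcu' hupos huper hper' hs hsper
  have hcint : ∀ c : ℝ, Continuous fun x =>
      4 * (deriv u x * sin ((s x - c) / 2) + cos ((s x - c) / 2) / (2 * u x)) ^ 2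
        - (u x * sin ((s x - c) / 2)) ^ 2 := fun c => by
    have hq : Continuous fun x => cos ((s x - c) / 2) / (2 * u x) :=
      Continuous.div (by fun_prop) (by fun_prop) fun x => by have := hupos x; positivity
    fun_prop
  have hcE : Continuous fun x => u x ^ 2 - 4 * deriv u x ^ 2 := by fun_prop
  have hmain : (∫ θ in (0:ℝ)..(2 * π), ((u θ) ^ 2 - 4 * (deriv u θ) ^ 2)) ≤ 2 * π := by
    have hsum := add_nonneg (hphase 0) (hphase b)
    rw [← intervalIntegral.integral_add ((hcint _).intervalIntegrable _ _)
      ((hcint _).intervalIntegrable _ _)] at hsum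
    have hpt : ∀ x, (4 * (deriv u x * sin ((s x - s 0) / 2)
          + cos ((s x - s 0) / 2) / (2 * u x)) ^ 2 - (u x * sin ((s x - s 0) / 2)) ^ 2)
        + (4 * (deriv u x * sin ((s x - s b) / 2)
          + cos ((s x - s b) / 2) / (2 * u x)) ^ 2 - (u x * sin ((s x - s b) / 2)) ^ 2)
        = (u x ^ 2)⁻¹ - (u x ^ 2 - 4 * deriv u x ^ 2) := fun x => by
      rw [hs0, hb, sub_zero, sub_div, sin_sub_pi_div_two, cos_sub_pi_div_two]
      have hx := (hupos x).ne'
      have hsc := sin_sq_add_cos_sq (s x / 2)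
      field_simp
      linear_combination (4 * (4 * deriv u x ^ 2 * u x ^ 2 + 1 - u x ^ 4)) * hsc
    simp only [hpt] at hsum
    rw [intervalIntegral.integral_sub (hci.intervalIntegrable _ _)
      (hcE.intervalIntegrable _ _), hnorm] at hsum
    linarith
  have hparts : (∫ θ in (0:ℝ)..(2 * π),
      ((u θ) ^ 3 * (4 * deriv (deriv u) θ + u θ)) * ((u θ) ^ 2)⁻¹)
      = ∫ θ in (0:ℝ)..(2 * π), ((u θ) ^ 2 - 4 * (deriv u θ) ^ 2) := by
    have hd : ∀ x, HasDerivAt (fun x => 4 * (u x * deriv u x))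
        (4 * (deriv u x * deriv u x + u x * deriv (deriv u) x)) x := fun x =>
      ((hu1 x).fun_mul (hu2 x)).const_mul 4
    have hcd : Continuous fun x => 4 * (deriv u x * deriv u x + u x * deriv (deriv u) x) := by
      fun_prop
    have hzero := intervalIntegral.integral_eq_sub_of_hasDerivAt (a := 0) (b := 2 * π)
      (fun x _ => hd x) (hcd.intervalIntegrable _ _)
    have e0 := huper 0
    have e1 := hper' 0
    rw [zero_add] at e0 e1
    rw [e0, e1, sub_self] at hzero
    have hadd := intervalIntegral.integral_add (f := fun x => u x ^ 2 - 4 * deriv u x ^ 2)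
      (μ := volume) (hcE.intervalIntegrable 0 (2 * π))
      (hcd.intervalIntegrable 0 (2 * π))
    rw [hzero, add_zero] at hadd
    rw [← hadd]
    refine intervalIntegral.integral_congr fun x _ => ?_
    have hx := (hupos x).ne'
    field_simp
    ring
  refine ⟨?_, hmain⟩
  rw [hparts, one_div, inv_mul_le_iff₀ (by positivity), mul_one]
  exact hmain
end

section
/- Let u : ℝ × [0,∞) → ℝ be a smooth function, 2π-periodic in its first variable, with u(θ,t) > 0 everywhere, satisfying the normalized affine flow ∂_t u = (1/4)(κ − κ̄)·u with κ(θ,t) = u³·(∂²_θ u + u) and κ̄(t) = (∫_0^{2π} κ u^{−2} dθ)/(∫_0^{2π} u^{−2} dθ). If ∫_0^{2π} u(θ,0)^{−3} cos θ dθ = ∫_0^{2π} u(θ,0)^{−3} sin θ dθ = 0, then for every t > 0 one has ∫_0^{2π} u(θ,t)^{−3} cos θ dθ = ∫_0^{2π} u(θ,t)^{−3} sin θ dθ = 0. -/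
open Real MeasureTheory

open Filter Set in
/-- Differentiation under the integral sign for a jointly continuous integrand whose partial
derivative in the parameter is jointly continuous. -/
theorem hasDerivAt_intervalIntegral_of_continuous_deriv {F F' : ℝ → ℝ → ℝ} {a b : ℝ}
    (hF : Continuous fun p : ℝ × ℝ => F p.1 p.2) (hF' : Continuous fun p : ℝ × ℝ => F' p.1 p.2)
    (hderiv : ∀ t x, HasDerivAt (fun s => F s x) (F' t x) t) (t : ℝ) :
    HasDerivAt (fun s => ∫ x in a..b, F s x) (∫ x in a..b, F' t x) t := by
  have hFt : ∀ s, Continuous (F s) := fun s => hF.comp (by fun_prop : Continuous fun x => (s, x))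
  have hF't : Continuous (F' t) := hF'.comp (by fun_prop : Continuous fun x => (t, x))
  obtain ⟨C, hC⟩ := ((isCompact_Icc (a := t - 1) (b := t + 1)).prod
    (isCompact_uIcc (a := a) (b := b))).exists_bound_of_continuousOn hF'.continuousOn
  refine (intervalIntegral.hasDerivAt_integral_of_dominated_loc_of_deriv_le (bound := fun _ => C)
    (Icc_mem_nhds (by linarith) (by linarith) : Icc (t - 1) (t + 1) ∈ nhds t)
    (Eventually.of_forall fun s => (hFt s).aestronglyMeasurable)
    ((hFt t).intervalIntegrable _ _) hF't.aestronglyMeasurable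
    (Eventually.of_forall fun x hx s hs => ?_) intervalIntegrable_const
    (Eventually.of_forall fun x _ s _ => hderiv s x)).2
  exact hC (s, x) ⟨hs, uIoc_subset_uIcc hx⟩

theorem exists_contDiff_hasDerivAt_fst {u : ℝ → ℝ → ℝ}
    (hu : ContDiff ℝ (⊤ : ℕ∞) fun p : ℝ × ℝ => u p.1 p.2) :
    ∃ v : ℝ → ℝ → ℝ, ContDiff ℝ (⊤ : ℕ∞) (fun p : ℝ × ℝ => v p.1 p.2) ∧
      ∀ x t, HasDerivAt (fun y => u y t) (v x t) x := by
  refine ⟨fun x t => fderiv ℝ (fun p : ℝ × ℝ => u p.1 p.2) (x, t) (1, 0),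
    (hu.fderiv_right (m := (⊤ : ℕ∞)) (by simp)).clm_apply contDiff_const, fun x t => ?_⟩
  have h := (hu.differentiable (by simp) (x, t)).hasFDerivAt
  exact h.comp_hasDerivAt x ((hasDerivAt_id x).prodMk (hasDerivAt_const x t))

theorem exists_contDiff_hasDerivAt_snd {u : ℝ → ℝ → ℝ}
    (hu : ContDiff ℝ (⊤ : ℕ∞) fun p : ℝ × ℝ => u p.1 p.2) :
    ∃ v : ℝ → ℝ → ℝ, ContDiff ℝ (⊤ : ℕ∞) (fun p : ℝ × ℝ => v p.1 p.2) ∧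
      ∀ x t, HasDerivAt (fun s => u x s) (v x t) t := by
  have hswap : ContDiff ℝ (⊤ : ℕ∞) fun p : ℝ × ℝ => u p.2 p.1 :=
    hu.comp (contDiff_snd.prodMk contDiff_fst)
  obtain ⟨v, hv, hd⟩ := exists_contDiff_hasDerivAt_fst (u := fun t x => u x t) hswap
  exact ⟨fun x t => v t x, hv.comp (contDiff_snd.prodMk contDiff_fst), fun x t => hd t x⟩

/-- A periodic function of the form `f'' + f` is orthogonal to every solution `φ` of
`φ'' + φ = 0` of the same period. -/
theorem integral_deriv_deriv_add_self_mul_eq_zero {f f' f'' φ ψ : ℝ → ℝ} {a b : ℝ}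
    (hf : ∀ x, HasDerivAt f (f' x) x) (hf' : ∀ x, HasDerivAt f' (f'' x) x)
    (hf'' : Continuous f'')
    (hφ : ∀ x, HasDerivAt φ (ψ x) x) (hψ : ∀ x, HasDerivAt ψ (-φ x) x)
    (hfab : f b = f a) (hfab' : f' b = f' a) (hφab : φ b = φ a) (hψab : ψ b = ψ a) :
    ∫ x in a..b, (f'' x + f x) * φ x = 0 := by
  have hfc : Continuous f := continuous_iff_continuousAt.2 fun x => (hf x).continuousAt
  have hφc : Continuous φ := continuous_iff_continuousAt.2 fun x => (hφ x).continuousAt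
  have hint : IntervalIntegrable (fun x => (f'' x + f x) * φ x) volume a b :=
    ((hf''.add hfc).mul hφc).intervalIntegrable _ _
  rw [intervalIntegral.integral_eq_sub_of_hasDerivAt (f := fun x => f' x * φ x - f x * ψ x)
    (fun x _ => ?_) hint]
  · simp only [hfab, hfab', hφab, hψab, sub_self]
  · exact (((hf' x).mul (hφ x)).sub ((hf x).mul (hψ x))).congr_deriv (by ring)

/-- Along the normalized affine flow, a vanishing moment of `u⁻³` against a `2π`-periodic
solution `φ` of `φ'' + φ = 0` stays zero. -/
theorem affine_flow_moment_preserved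
    {u : ℝ → ℝ → ℝ}
    (hu : ContDiff ℝ (⊤ : ℕ∞) (fun p : ℝ × ℝ => u p.1 p.2))
    (huper : ∀ θ t, u (θ + 2 * π) t = u θ t)
    (hupos : ∀ θ t, 0 < u θ t)
    {kappa : ℝ → ℝ → ℝ}
    (hkappa : ∀ θ t, kappa θ t = (u θ t) ^ 3 * (deriv (deriv (fun x => u x t)) θ + u θ t))
    {kbar : ℝ → ℝ}
    (hflow : ∀ θ t, 0 ≤ t →
      deriv (fun s => u θ s) t = (1 / 4) * (kappa θ t - kbar t) * u θ t)
    {φ ψ : ℝ → ℝ} (hφ : ∀ x, HasDerivAt φ (ψ x) x) (hψ : ∀ x, HasDerivAt ψ (-φ x) x)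
    (hφper : φ (2 * π) = φ 0) (hψper : ψ (2 * π) = ψ 0)
    (h0 : ∫ θ in (0:ℝ)..(2 * π), ((u θ 0) ^ 3)⁻¹ * φ θ = 0) {t : ℝ} (ht : 0 ≤ t) :
    ∫ θ in (0:ℝ)..(2 * π), ((u θ t) ^ 3)⁻¹ * φ θ = 0 := by
  obtain ⟨ux, hux, hdx⟩ := exists_contDiff_hasDerivAt_fst hu
  obtain ⟨uxx, huxx, hdxx⟩ := exists_contDiff_hasDerivAt_fst hux
  obtain ⟨ut, hut, hdt⟩ := exists_contDiff_hasDerivAt_snd hu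
  have hne : ∀ θ t, u θ t ≠ 0 := fun θ t => (hupos θ t).ne'
  have hφc : Continuous φ := continuous_iff_continuousAt.2 fun x => (hφ x).continuousAt
  have hswap {w : ℝ → ℝ → ℝ} (hw : ContDiff ℝ (⊤ : ℕ∞) fun p : ℝ × ℝ => w p.1 p.2) :
      Continuous fun p : ℝ × ℝ => w p.2 p.1 := hw.continuous.comp continuous_swap
  have hslice {w : ℝ → ℝ → ℝ} (hw : ContDiff ℝ (⊤ : ℕ∞) fun p : ℝ × ℝ => w p.1 p.2) (s : ℝ) :
      Continuous fun θ => w θ s :=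
    hw.continuous.comp (by fun_prop : Continuous fun θ : ℝ => (θ, s))
  have htime {w : ℝ → ℝ → ℝ} (hw : ContDiff ℝ (⊤ : ℕ∞) fun p : ℝ × ℝ => w p.1 p.2) (θ : ℝ) :
      Continuous fun s => w θ s :=
    hw.continuous.comp (by fun_prop : Continuous fun s : ℝ => (θ, s))
  have hflow' : ∀ θ s, 0 ≤ s →
      ut θ s = 1 / 4 * ((u θ s) ^ 3 * (uxx θ s + u θ s) - kbar s) * u θ s := by
    intro θ s hs
    have h1 : deriv (fun x => u x s) = fun x => ux x s := funext fun x => (hdx x s).deriv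
    rw [← (hdt θ s).deriv, hflow θ s hs, hkappa, h1, (hdxx θ s).deriv]
  have huxper : ∀ s, ux (2 * π) s = ux 0 s := by
    intro s
    have h1 := (hdx (0 + 2 * π) s).comp_add_const 0 (2 * π)
    simp only [huper, zero_add] at h1
    exact h1.unique (hdx 0 s)
  have hmoment : ∀ s, HasDerivAt (fun s => ∫ θ in (0:ℝ)..(2 * π), ((u θ s) ^ 3)⁻¹ * φ θ)
      (∫ θ in (0:ℝ)..(2 * π), -(3 * (u θ s) ^ 2 * ut θ s) / ((u θ s) ^ 3) ^ 2 * φ θ) s := by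
    refine hasDerivAt_intervalIntegral_of_continuous_deriv
      (F := fun s θ => ((u θ s) ^ 3)⁻¹ * φ θ)
      (F' := fun s θ => -(3 * (u θ s) ^ 2 * ut θ s) / ((u θ s) ^ 3) ^ 2 * φ θ) ?_ ?_ ?_
    · exact (((hswap hu).pow 3).inv₀ fun p => pow_ne_zero 3 (hne _ _)).mul
        (hφc.comp continuous_snd)
    · exact ((((continuous_const.mul ((hswap hu).pow 2)).mul (hswap hut)).neg).div
        (((hswap hu).pow 3).pow 2) fun p => pow_ne_zero 2 (pow_ne_zero 3 (hne _ _))).mul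
        (hφc.comp continuous_snd)
    · intro s θ
      have h1 := (((hdt θ s).fun_pow 3).fun_inv (pow_ne_zero 3 (hne θ s))).mul_const (φ θ)
      exact h1.congr_deriv (by norm_num)
  have hlinear : ∀ s, 0 ≤ s →
      ∫ θ in (0:ℝ)..(2 * π), -(3 * (u θ s) ^ 2 * ut θ s) / ((u θ s) ^ 3) ^ 2 * φ θ =
        3 / 4 * kbar s * ∫ θ in (0:ℝ)..(2 * π), ((u θ s) ^ 3)⁻¹ * φ θ := by
    intro s hs
    have hzero := integral_deriv_deriv_add_self_mul_eq_zero (a := 0) (b := 2 * π)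
      (fun x => hdx x s) (fun x => hdxx x s) (hslice huxx s) hφ hψ
      (by simpa using huper 0 s) (huxper s) hφper hψper
    have hpt : ∀ θ, -(3 * (u θ s) ^ 2 * ut θ s) / ((u θ s) ^ 3) ^ 2 * φ θ =
        3 / 4 * kbar s * (((u θ s) ^ 3)⁻¹ * φ θ) - 3 / 4 * ((uxx θ s + u θ s) * φ θ) := by
      intro θ
      have := hne θ s
      rw [hflow' θ s hs]
      field_simp
      ring
    simp only [hpt]
    rw [intervalIntegral.integral_sub, intervalIntegral.integral_const_mul,
      intervalIntegral.integral_const_mul, hzero, mul_zero, sub_zero]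
    · exact (continuous_const.mul ((((hslice hu s).pow 3).inv₀ fun θ =>
        pow_ne_zero 3 (hne _ _)).mul hφc)).intervalIntegrable _ _
    · exact (continuous_const.mul (((hslice huxx s).add (hslice hu s)).mul
        hφc)).intervalIntegrable _ _
  have hkbarc : ContinuousOn kbar (Set.Icc 0 t) := by
    have hc : Continuous fun s => (u 0 s) ^ 3 * (uxx 0 s + u 0 s) - 4 * ut 0 s / u 0 s :=
      (((htime hu 0).pow 3).mul ((htime huxx 0).add (htime hu 0))).sub
        ((continuous_const.mul (htime hut 0)).div (htime hu 0) (hne 0))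
    refine hc.continuousOn.congr fun s hs => ?_
    have := hne 0 s
    simp only [hflow' 0 s hs.1]
    field_simp
    ring
  obtain ⟨C, hC⟩ := isCompact_Icc.exists_bound_of_continuousOn hkbarc
  refine eq_zero_of_abs_deriv_le_mul_abs_self_of_eq_zero_right (K := 3 / 4 * C) (a := 0) (b := t)
    (fun s _ => (hmoment s).continuousAt.continuousWithinAt)
    (fun s _ => (hmoment s).hasDerivWithinAt) h0 (fun s hs => ?_) t ⟨ht, le_rfl⟩
  rw [hlinear s hs.1, norm_mul, norm_mul, Real.norm_of_nonneg (by norm_num : (0:ℝ) ≤ 3 / 4)]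
  gcongr
  exact hC s (Set.Ico_subset_Icc_self hs)

/-- The orthogonality condition `∫ u⁻³cosθ = ∫ u⁻³sinθ = 0` is preserved
under the normalized affine flow on S¹. -/
theorem affine_flow_orthogonality_preserved
    (u : ℝ → ℝ → ℝ)
    (hu : ContDiff ℝ (⊤ : ℕ∞) (fun p : ℝ × ℝ => u p.1 p.2))
    (huper : ∀ θ t, u (θ + 2 * π) t = u θ t)
    (hupos : ∀ θ t, 0 < u θ t)
    (kappa : ℝ → ℝ → ℝ)
    (hkappa : ∀ θ t, kappa θ t = (u θ t) ^ 3 * (deriv (deriv (fun x => u x t)) θ + u θ t))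
    (kbar : ℝ → ℝ)
    (hkbar : ∀ t, kbar t =
      (∫ θ in (0:ℝ)..(2 * π), kappa θ t * ((u θ t) ^ 2)⁻¹) /
        ∫ θ in (0:ℝ)..(2 * π), ((u θ t) ^ 2)⁻¹)
    (hflow : ∀ θ t, 0 ≤ t →
      deriv (fun s => u θ s) t = (1 / 4) * (kappa θ t - kbar t) * u θ t)
    (horth0c : ∫ θ in (0:ℝ)..(2 * π), ((u θ 0) ^ 3)⁻¹ * Real.cos θ = 0)
    (horth0s : ∫ θ in (0:ℝ)..(2 * π), ((u θ 0) ^ 3)⁻¹ * Real.sin θ = 0) :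
    ∀ t : ℝ, 0 < t →
      (∫ θ in (0:ℝ)..(2 * π), ((u θ t) ^ 3)⁻¹ * Real.cos θ = 0)
      ∧ (∫ θ in (0:ℝ)..(2 * π), ((u θ t) ^ 3)⁻¹ * Real.sin θ = 0) := by
  intro t ht
  exact ⟨affine_flow_moment_preserved hu huper hupos hkappa hflow (ψ := fun x => -Real.sin x)
      Real.hasDerivAt_cos (fun x => (Real.hasDerivAt_sin x).neg) (by simp) (by simp) horth0c ht.le,
    affine_flow_moment_preserved hu huper hupos hkappa hflow
      Real.hasDerivAt_sin Real.hasDerivAt_cos (by simp) (by simp) horth0s ht.le⟩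
end

section
/- Let u : ℝ × [0,∞) → ℝ be a smooth function, 2π-periodic in its first variable, with u(θ,t) > 0 everywhere, satisfying the normalized Yamabe flow ∂_t u = (1/4)(R − R̄)·u with R(θ,t) = u³·(4·∂²_θ u + u), R̄(t) = (∫_0^{2π} R u^{−2} dθ)/(∫_0^{2π} u^{−2} dθ), and ∫_0^{2π} u(θ,0)^{−2} dθ = 2π. Then there exists a constant C > 0 such that |∂_θ u(θ,t)| ≤ C·u(θ,t) for all θ ∈ ℝ and all t ∈ [0,∞). -/
open Real MeasureTheory

open Set Topology

/-- Pullback of the `-1/2`-density `v` on the circle to the real line along `y ↦ c + 2 arctan (s y)`,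
multiplied by `k`. -/
noncomputable def stereoPullback (s k c : ℝ) (v : ℝ → ℝ) (y : ℝ) : ℝ :=
  k * √(1 + (s * y) ^ 2) * v (c + 2 * arctan (s * y))

theorem hasDerivAt_sqrt_one_add_mul_sq (s y : ℝ) :
    HasDerivAt (fun y : ℝ => √(1 + (s * y) ^ 2)) (s ^ 2 * y / √(1 + (s * y) ^ 2)) y := by
  have h0 : 0 < 1 + (s * y) ^ 2 := by positivity
  have h1 : HasDerivAt (fun y : ℝ => 1 + (s * y) ^ 2) (2 * s ^ 2 * y) y := by
    have h2 : HasDerivAt (fun y : ℝ => s * y) s y := by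
      simpa using (hasDerivAt_id y).const_mul s
    have h3 := (h2.pow 2).const_add 1
    exact h3.congr_deriv (by push_cast; ring)
  have h2 := h1.sqrt h0.ne'
  convert h2 using 1
  have := Real.sqrt_pos.2 h0
  field_simp

theorem hasDerivAt_stereo_angle (s c y : ℝ) :
    HasDerivAt (fun y : ℝ => c + 2 * arctan (s * y)) (2 * s / √(1 + (s * y) ^ 2) ^ 2) y := by
  have h2 : HasDerivAt (fun y : ℝ => s * y) s y := by
    simpa using (hasDerivAt_id y).const_mul s
  have h3 := (h2.arctan.const_mul 2).const_add c
  refine h3.congr_deriv ?_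
  rw [Real.sq_sqrt (by positivity)]
  ring

theorem hasDerivAt_stereoPullback (s k c : ℝ) {v : ℝ → ℝ} {v' y : ℝ}
    (hv : HasDerivAt v v' (c + 2 * arctan (s * y))) :
    HasDerivAt (stereoPullback s k c v)
      (k * (2 * s * v' + s ^ 2 * y * v (c + 2 * arctan (s * y))) / √(1 + (s * y) ^ 2)) y := by
  have hS : 0 < √(1 + (s * y) ^ 2) := Real.sqrt_pos.2 (by positivity)
  have h := ((hasDerivAt_sqrt_one_add_mul_sq s y).const_mul k).mul
    (HasDerivAt.comp y hv (hasDerivAt_stereo_angle s c y))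
  refine h.congr_deriv ?_
  simp only [Function.comp]
  field_simp
  ring

theorem hasDerivAt_deriv_stereoPullback (s k c : ℝ) {v v' : ℝ → ℝ} {v'' : ℝ} (y : ℝ)
    (hv : ∀ x, HasDerivAt v (v' x) x)
    (hv' : HasDerivAt v' v'' (c + 2 * arctan (s * y))) :
    HasDerivAt (deriv (stereoPullback s k c v))
      (k * s ^ 2 * (4 * v'' + v (c + 2 * arctan (s * y))) / √(1 + (s * y) ^ 2) ^ 3) y := by
  have hd : deriv (stereoPullback s k c v) = fun y =>
      k * (2 * s * v' (c + 2 * arctan (s * y)) + s ^ 2 * y * v (c + 2 * arctan (s * y))) /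
        √(1 + (s * y) ^ 2) :=
    funext fun y => (hasDerivAt_stereoPullback s k c (hv _)).deriv
  have hS : 0 < √(1 + (s * y) ^ 2) := Real.sqrt_pos.2 (by positivity)
  have hSS : √(1 + (s * y) ^ 2) ^ 2 = 1 + (s * y) ^ 2 := Real.sq_sqrt (by positivity)
  have hθ := hasDerivAt_stereo_angle s c y
  have h := ((((HasDerivAt.comp y hv' hθ).const_mul (2 * s)).add
    (((hasDerivAt_id y).const_mul (s ^ 2)).mul
      (HasDerivAt.comp y (hv _) hθ))).const_mul k).div
    (hasDerivAt_sqrt_one_add_mul_sq s y) hS.ne'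
  rw [hd]
  refine h.congr_deriv ?_
  simp only [Function.comp, id, Pi.add_apply, Pi.mul_apply]
  set S := √(1 + (s * y) ^ 2)
  field_simp
  linear_combination k * s ^ 2 * v (c + 2 * arctan (s * y)) * hSS

/-- The second derivative is nonnegative at a local minimum. -/
theorem IsLocalMin.deriv_deriv_nonneg {f : ℝ → ℝ} {x : ℝ} (h : IsLocalMin f x)
    (hc : ContinuousAt f x) : 0 ≤ deriv (deriv f) x := by
  by_contra! hneg
  have hmax := isLocalMax_of_deriv_deriv_neg hneg h.deriv_eq_zero hc
  have hconst : f =ᶠ[𝓝 x] fun _ => f x := by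
    filter_upwards [h, hmax] with y h1 h2 using le_antisymm h2 h1
  have h2 := hconst.deriv.deriv_eq
  simp at h2
  linarith

/-- At a minimum over a left neighbourhood the derivative is nonpositive. -/
theorem HasDerivAt.nonpos_of_le_left {f : ℝ → ℝ} {f' a b : ℝ} (hab : a < b)
    (hf : HasDerivAt f f' b) (hmin : ∀ x ∈ Icc a b, f b ≤ f x) : f' ≤ 0 := by
  have h1 := (hasDerivWithinAt_iff_tendsto_slope' (s := Iio b) (by simp)).1 hf.hasDerivWithinAt
  refine le_of_tendsto h1 ?_
  filter_upwards [Ioo_mem_nhdsLT hab] with x hx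
  rw [slope_def_field]
  exact div_nonpos_of_nonneg_of_nonpos (sub_nonneg.2 (hmin x ⟨hx.1.le, hx.2.le⟩))
    (sub_nonpos.2 hx.2.le)

/-- Weak minimum principle for a linear parabolic equation on `[-1, 1] × [0, τ]`. -/
theorem parabolic_minimum_principle {h A b ht : ℝ → ℝ → ℝ} {τ : ℝ} (hτ : 0 ≤ τ)
    (hc : Continuous fun p : ℝ × ℝ => h p.1 p.2)
    (hb : Continuous fun p : ℝ × ℝ => b p.1 p.2)
    (hA : ∀ y t, 0 ≤ A y t)
    (hht : ∀ y t, HasDerivAt (fun s => h y s) (ht y t) t)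
    (heq : ∀ y t, 0 ≤ t → ht y t = A y t * deriv (deriv fun x => h x t) y + b y t * h y t)
    (hinit : ∀ y ∈ Icc (-1 : ℝ) 1, 0 ≤ h y 0)
    (hleft : ∀ t, 0 ≤ t → 0 ≤ h (-1) t) (hright : ∀ t, 0 ≤ t → 0 ≤ h 1 t) :
    ∀ y ∈ Icc (-1 : ℝ) 1, 0 ≤ h y τ := by
  have hcomp : IsCompact (Icc (-1 : ℝ) 1 ×ˢ Icc 0 τ) := isCompact_Icc.prod isCompact_Icc
  obtain ⟨K, hK⟩ := hcomp.bddAbove_image hb.continuousOn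
  set m : ℝ → ℝ → ℝ := fun y t => exp (-(K + 1) * t) * h y t with hm
  have hmc : Continuous fun p : ℝ × ℝ => m p.1 p.2 := by
    simp only [hm]
    fun_prop
  obtain ⟨⟨y₀, t₀⟩, hmem, hmin⟩ := hcomp.exists_isMinOn
    ⟨((0 : ℝ), (0 : ℝ)), ⟨by constructor <;> norm_num, ⟨le_rfl, hτ⟩⟩⟩ hmc.continuousOn
  obtain ⟨hy₀, ht₀⟩ := hmem
  simp only at hy₀ ht₀
  have hmin' : ∀ y ∈ Icc (-1 : ℝ) 1, ∀ t ∈ Icc 0 τ, m y₀ t₀ ≤ m y t :=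
    fun y hy t ht => hmin (show (y, t) ∈ _ from ⟨hy, ht⟩)
  suffices h0 : 0 ≤ h y₀ t₀ by
    intro y hy
    have h1 : 0 ≤ m y₀ t₀ := mul_nonneg (exp_pos _).le h0
    exact nonneg_of_mul_nonneg_right (h1.trans (hmin' y hy τ ⟨hτ, le_rfl⟩)) (exp_pos _)
  by_contra! hneg
  have ht_pos : 0 < t₀ := by
    rcases ht₀.1.eq_or_lt with h1 | h1
    · rw [← h1] at hneg
      exact absurd (hinit y₀ hy₀) (not_le.2 hneg)
    · exact h1
  have hy1 : -1 < y₀ := by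
    rcases hy₀.1.eq_or_lt with h1 | h1
    · rw [← h1] at hneg
      exact absurd (hleft t₀ ht₀.1) (not_le.2 hneg)
    · exact h1
  have hy2 : y₀ < 1 := by
    rcases hy₀.2.eq_or_lt with h1 | h1
    · rw [h1] at hneg
      exact absurd (hright t₀ ht₀.1) (not_le.2 hneg)
    · exact h1
  have hloc : IsLocalMin (fun x => h x t₀) y₀ := by
    filter_upwards [Icc_mem_nhds hy1 hy2] with x hx
    exact le_of_mul_le_mul_left (hmin' x hx t₀ ht₀) (exp_pos _)
  have hyy := hloc.deriv_deriv_nonneg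
    (hc.comp (Continuous.prodMk continuous_id continuous_const)).continuousAt
  have hmt : HasDerivAt (fun s => m y₀ s)
      (exp (-(K + 1) * t₀) * (-(K + 1) * h y₀ t₀ + ht y₀ t₀)) t₀ := by
    have h1 : HasDerivAt (fun s : ℝ => -(K + 1) * s) (-(K + 1)) t₀ := by
      simpa using (hasDerivAt_id t₀).const_mul (-(K + 1))
    exact (h1.exp.mul (hht y₀ t₀)).congr_deriv (by ring)
  have hle := hmt.nonpos_of_le_left ht_pos
    fun s hs => hmin' y₀ hy₀ s ⟨hs.1, hs.2.trans ht₀.2⟩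
  have hbK : b y₀ t₀ ≤ K := hK ⟨(y₀, t₀), ⟨hy₀, ht₀⟩, rfl⟩
  have hpos : 0 < -(K + 1) * h y₀ t₀ + ht y₀ t₀ := by
    rw [heq y₀ t₀ ht₀.1]
    nlinarith [mul_nonneg (hA y₀ t₀) hyy]
  exact absurd hle (not_le.2 (mul_pos (exp_pos _) hpos))

theorem contDiff_partial_fst {u : ℝ → ℝ → ℝ}
    (hu : ContDiff ℝ (⊤ : ℕ∞) fun p : ℝ × ℝ => u p.1 p.2) :
    ContDiff ℝ (⊤ : ℕ∞) fun p : ℝ × ℝ => deriv (fun x => u x p.2) p.1 := by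
  have h1 : (fun p : ℝ × ℝ => deriv (fun x => u x p.2) p.1) =
      fun p : ℝ × ℝ => fderiv ℝ (fun p : ℝ × ℝ => u p.1 p.2) p (1, 0) := by
    funext p
    have h2 : HasFDerivAt (fun p : ℝ × ℝ => u p.1 p.2) _ (p.1, p.2) :=
      (hu.differentiable (by simp) p).hasFDerivAt
    have h3 : HasDerivAt (fun x : ℝ => (x, p.2)) ((1 : ℝ), (0 : ℝ)) p.1 :=
      (hasDerivAt_id p.1).prodMk (hasDerivAt_const _ _)
    exact (h2.comp_hasDerivAt p.1 h3).deriv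
  rw [h1]
  exact (hu.fderiv_right (by simp)).clm_apply contDiff_const

theorem contDiff_swap {u : ℝ → ℝ → ℝ}
    (hu : ContDiff ℝ (⊤ : ℕ∞) fun p : ℝ × ℝ => u p.1 p.2) :
    ContDiff ℝ (⊤ : ℕ∞) fun p : ℝ × ℝ => u p.2 p.1 :=
  hu.comp (contDiff_snd.prodMk contDiff_fst)

theorem differentiable_slice {u : ℝ → ℝ → ℝ}
    (hu : ContDiff ℝ (⊤ : ℕ∞) fun p : ℝ × ℝ => u p.1 p.2) (t : ℝ) :
    Differentiable ℝ fun x => u x t :=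
  (hu.comp (contDiff_id.prodMk contDiff_const)).differentiable (by simp)

/-- A positive periodic `C¹` function satisfies a linear Harnack inequality. -/
theorem exists_le_mul_one_add {v : ℝ → ℝ} {P : ℝ} (hP : 0 < P) (hv : ContDiff ℝ 1 v)
    (hper : Function.Periodic v P) (hpos : ∀ x, 0 < v x) :
    ∃ L : ℝ, 0 ≤ L ∧ ∀ a b, v a ≤ v b * (1 + L * |a - b|) := by
  obtain ⟨x₀, -, hx₀⟩ := (isCompact_Icc (a := (0 : ℝ)) (b := P)).exists_isMinOn
    ⟨0, le_rfl, hP.le⟩ hv.continuous.continuousOn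
  have hmin : ∀ x, v x₀ ≤ v x := fun x => by
    obtain ⟨y, hy, hxy⟩ := hper.exists_mem_Ico₀ hP x
    rw [hxy]
    exact hx₀ (Ico_subset_Icc_self hy)
  have hv' : Continuous (deriv v) := hv.continuous_deriv le_rfl
  have hper' : Function.Periodic (deriv v) P := fun x => by
    rw [← deriv_comp_add_const]
    congr 1
    exact funext hper
  obtain ⟨M, hM⟩ := (isCompact_Icc (a := (0 : ℝ)) (b := P)).exists_bound_of_continuousOn
    hv'.continuousOn
  have hbd : ∀ x, ‖deriv v x‖ ≤ M := fun x => by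
    obtain ⟨y, hy, hxy⟩ := hper'.exists_mem_Ico₀ hP x
    rw [hxy]
    exact hM y (Ico_subset_Icc_self hy)
  have hM0 : 0 ≤ M := (norm_nonneg _).trans (hbd 0)
  refine ⟨M / v x₀, div_nonneg hM0 (hpos x₀).le, fun a b => ?_⟩
  have h1 := convex_univ.norm_image_sub_le_of_norm_deriv_le
    (fun x _ => hv.differentiable (by simp) x) (fun x _ => hbd x) (mem_univ b) (mem_univ a)
  rw [Real.norm_eq_abs, Real.norm_eq_abs] at h1
  have h2 : M * |a - b| ≤ v b * (M / v x₀ * |a - b|) := by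
    rw [← mul_assoc]
    refine mul_le_mul_of_nonneg_right ?_ (abs_nonneg _)
    rw [mul_div_assoc', le_div_iff₀ (hpos x₀)]
    nlinarith [hmin b]
  linarith [(abs_le.1 h1).2]

theorem arctan_sub_arctan_le {a b : ℝ} (hab : a ≤ b) : arctan b - arctan a ≤ b - a := by
  have h := convex_univ.norm_image_sub_le_of_norm_deriv_le (f := arctan) (C := 1)
    (fun x _ => differentiable_arctan x) (fun x _ => ?_) (mem_univ a) (mem_univ b)
  · rw [Real.norm_eq_abs, Real.norm_eq_abs, one_mul, abs_of_nonneg (sub_nonneg.2 hab)] at h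
    exact (le_abs_self _).trans h
  · rw [Real.deriv_arctan, Real.norm_eq_abs, abs_of_nonneg (by positivity)]
    exact div_le_one_of_le₀ (by nlinarith [sq_nonneg x]) (by positivity)

/-- The elementary inequality behind the initial ordering of a function and its inversion in a
short arc. -/
theorem sqrt_mul_one_add_le {L T η y Δ : ℝ} (hL : 0 ≤ L) (hη : 0 < η) (hT : 0 < T)
    (hT2 : T ≤ 1 / 2) (hη1 : (T ^ 2 + η ^ 2) * (1 + L * π) ^ 2 ≤ 1) (hLT : 16 * L * T ≤ η)
    (hy : 0 ≤ y) (hy1 : y ≤ 1) (hΔπ : Δ ≤ π) (hΔ : 0 < y → Δ ≤ 2 * T * (1 - y ^ 2) / y)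
    (hΔ0 : 0 ≤ Δ) :
    √(T ^ 2 + y ^ 2) * (1 + L * Δ) ≤ √(1 + (T * y) ^ 2) := by
  have hLΔ : 0 ≤ L * Δ := mul_nonneg hL hΔ0
  refine Real.le_sqrt_of_sq_le ?_
  rw [mul_pow, Real.sq_sqrt (by positivity)]
  rcases le_total y η with h | h
  · have h1 : T ^ 2 + y ^ 2 ≤ T ^ 2 + η ^ 2 := by gcongr
    have h2 : (1 + L * Δ) ^ 2 ≤ (1 + L * π) ^ 2 := by gcongr
    calc (T ^ 2 + y ^ 2) * (1 + L * Δ) ^ 2 ≤ (T ^ 2 + η ^ 2) * (1 + L * π) ^ 2 := by gcongr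
      _ ≤ 1 := hη1
      _ ≤ 1 + (T * y) ^ 2 := by nlinarith [sq_nonneg (T * y)]
  · have hy0 : 0 < y := hη.trans_le h
    set z := 1 - y ^ 2 with hz
    have hz0 : 0 ≤ z := by nlinarith
    have hz1 : z ≤ 1 := by nlinarith
    have h1 : L * Δ ≤ z / 8 := by
      calc L * Δ ≤ L * (2 * T * z / y) := by gcongr; exact hΔ hy0
        _ = (16 * L * T) / y * (z / 8) := by ring
        _ ≤ 1 * (z / 8) := by
          gcongr
          rw [div_le_one hy0]
          exact hLT.trans h
        _ = z / 8 := one_mul _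
    have hT4 : T ^ 2 ≤ 1 / 4 := by nlinarith
    have hyz : y ^ 2 = 1 - z := by rw [hz]; ring
    calc (T ^ 2 + y ^ 2) * (1 + L * Δ) ^ 2 ≤ (T ^ 2 + y ^ 2) * (1 + z / 8) ^ 2 := by gcongr
      _ ≤ 1 + (T * y) ^ 2 := by
        rw [mul_pow, hyz]
        have h3 : (1 + z / 8) ^ 2 ≤ 1 + z * (17 / 64) := by nlinarith
        have h4 : 0 ≤ T ^ 2 + (1 - z) := by nlinarith [sq_nonneg T]
        nlinarith [mul_le_mul_of_nonneg_left h3 h4, mul_nonneg hz0 hz0,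
          mul_nonneg hz0 (sub_nonneg.2 hT4)]

theorem exists_small_parameters {L : ℝ} (hL : 0 ≤ L) :
    ∃ T η : ℝ, 0 < η ∧ 0 < T ∧ T ≤ 1 / 2 ∧ (T ^ 2 + η ^ 2) * (1 + L * π) ^ 2 ≤ 1 ∧
      16 * L * T ≤ η := by
  have hπ := pi_gt_three
  have hLπ : 0 ≤ L * π := by positivity
  set N := 1 + L * π with hN
  have hN1 : 1 ≤ N := by linarith
  have hLN : L ≤ N := by nlinarith
  refine ⟨1 / (32 * N ^ 2), 1 / (2 * N), by positivity, by positivity, ?_, ?_, ?_⟩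
  · rw [div_le_div_iff₀ (by positivity) (by norm_num)]
    nlinarith
  · have h1 : (1 / (32 * N ^ 2)) ≤ 1 / (2 * N) := by
      rw [div_le_div_iff₀ (by positivity) (by positivity)]
      nlinarith
    have h2 : (1 / (32 * N ^ 2)) ^ 2 ≤ (1 / (2 * N)) ^ 2 := by gcongr
    have h3 : (1 / (2 * N)) ^ 2 * N ^ 2 = 1 / 4 := by field_simp; norm_num
    nlinarith [sq_nonneg N]
  · rw [mul_one_div, div_le_div_iff₀ (by positivity) (by positivity)]
    nlinarith

/-- If `v` satisfies a linear Harnack inequality then, in a short arc, it dominates its inversion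
in that arc. -/
theorem stereoPullback_inversion_le {v : ℝ → ℝ} {L T η : ℝ} (hL : 0 ≤ L)
    (hper : Function.Periodic v (2 * π)) (hpos : ∀ x, 0 < v x)
    (hharn : ∀ a b, v a ≤ v b * (1 + L * |a - b|)) (hη : 0 < η) (hT : 0 < T)
    (hT2 : T ≤ 1 / 2) (hη1 : (T ^ 2 + η ^ 2) * (1 + L * π) ^ 2 ≤ 1) (hLT : 16 * L * T ≤ η)
    (p : ℝ) : ∀ y ∈ Icc (-1 : ℝ) 1,
      stereoPullback (-T⁻¹) T (p + π) v y ≤ stereoPullback T 1 p v y := by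
  have hsqrt : ∀ y : ℝ, T * √(1 + (-T⁻¹ * y) ^ 2) = √(T ^ 2 + y ^ 2) := fun y => by
    rw [← Real.sqrt_sq hT.le, ← Real.sqrt_mul (by positivity), Real.sqrt_sq hT.le]
    congr 1
    field_simp
  have key : ∀ (y a b : ℝ), 0 ≤ y → y ≤ 1 →
      |a - b| = π - 2 * arctan (T⁻¹ * y) - 2 * arctan (T * y) →
      √(T ^ 2 + y ^ 2) * v a ≤ √(1 + (T * y) ^ 2) * v b := by
    intro y a b hy hy1 hab
    have hle := sqrt_mul_one_add_le (Δ := |a - b|) hL hη hT hT2 hη1 hLT hy hy1 ?_ ?_ (abs_nonneg _)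
    · calc √(T ^ 2 + y ^ 2) * v a ≤ √(T ^ 2 + y ^ 2) * (v b * (1 + L * |a - b|)) := by
            gcongr; exact hharn a b
        _ = √(T ^ 2 + y ^ 2) * (1 + L * |a - b|) * v b := by ring
        _ ≤ √(1 + (T * y) ^ 2) * v b := by
            gcongr; exact (hpos b).le
    · have h1 : 0 ≤ arctan (T⁻¹ * y) := arctan_nonneg.2 (by positivity)
      have h2 : 0 ≤ arctan (T * y) := arctan_nonneg.2 (by positivity)
      linarith
    · intro hy0
      have h1 : arctan (T⁻¹ * y) = π / 2 - arctan (T / y) := by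
        rw [← arctan_inv_of_pos (by positivity)]
        congr 1
        field_simp
      have hTy : T * y ≤ T / y := by
        rw [le_div_iff₀ hy0]
        nlinarith [mul_nonneg hT.le (sub_nonneg.2 hy1), mul_nonneg hT.le hy]
      have h2 : arctan (T / y) - arctan (T * y) ≤ T / y - T * y :=
        arctan_sub_arctan_le hTy
      rw [hab, h1]
      have h3 : 2 * T * (1 - y ^ 2) / y = 2 * (T / y - T * y) := by field_simp
      rw [h3]
      linarith
  have hangle : ∀ y : ℝ, 0 ≤ y → y ≤ 1 →
      0 ≤ π - 2 * arctan (T⁻¹ * y) - 2 * arctan (T * y) := by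
    intro y hy hy1
    have h1 : arctan (T⁻¹ * y) ≤ arctan T⁻¹ :=
      arctan_strictMono.monotone (mul_le_of_le_one_right (by positivity) hy1)
    have h2 : arctan (T * y) ≤ arctan T :=
      arctan_strictMono.monotone (mul_le_of_le_one_right hT.le hy1)
    have h3 := arctan_inv_of_pos hT
    linarith
  intro y hy
  simp only [stereoPullback]
  rw [hsqrt, one_mul]
  rcases le_total 0 y with h | h
  · refine key y _ _ h hy.2 ?_
    rw [neg_mul, arctan_neg, abs_of_nonneg] <;> linarith [hangle y h hy.2]
  · have h' : 0 ≤ -y := by linarith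
    have h1 := key (-y) (p + π + 2 * arctan (-T⁻¹ * y) - 2 * π) (p + 2 * arctan (T * y)) h'
      (by linarith [hy.1]) ?_
    · rw [hper.sub_eq] at h1
      simpa using h1
    · have h2 := hangle (-y) h' (by linarith [hy.1])
      rw [abs_of_nonpos] <;> simp only [mul_neg, arctan_neg, neg_mul] at h2 ⊢ <;> linarith

/-- The solution and its pullbacks solve the same equation, in flat coordinates. -/
theorem stereoPullback_evolution {u : ℝ → ℝ → ℝ} {ρ : ℝ → ℝ}
    (hu : ContDiff ℝ (⊤ : ℕ∞) fun p : ℝ × ℝ => u p.1 p.2)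
    (hflow : ∀ θ t, 0 ≤ t → deriv (fun s => u θ s) t =
      u θ t ^ 4 * (deriv (deriv fun x => u x t) θ + u θ t / 4) - ρ t * u θ t)
    {s k : ℝ} (hs : s ≠ 0) (hk : k ≠ 0) (c y t : ℝ) (ht : 0 ≤ t) :
    k * √(1 + (s * y) ^ 2) * deriv (fun τ => u (c + 2 * arctan (s * y)) τ) t =
      1 / (4 * (k ^ 4 * s ^ 2)) * stereoPullback s k c (fun x => u x t) y ^ 4 *
        deriv (deriv (stereoPullback s k c fun x => u x t)) y -
      ρ t * stereoPullback s k c (fun x => u x t) y := by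
  have h2 := (hasDerivAt_deriv_stereoPullback s k c y
    (fun x => (differentiable_slice hu t x).hasDerivAt)
    (differentiable_slice (u := fun x t => deriv (fun x => u x t) x)
      (contDiff_partial_fst hu) t _).hasDerivAt).deriv
  rw [h2, hflow _ _ ht]
  have hS : 0 < √(1 + (s * y) ^ 2) := Real.sqrt_pos.2 (by positivity)
  simp only [stereoPullback]
  field_simp

theorem contDiff_stereoPullback {u : ℝ → ℝ → ℝ}
    (hu : ContDiff ℝ (⊤ : ℕ∞) fun p : ℝ × ℝ => u p.1 p.2) (s k c : ℝ) :
    ContDiff ℝ (⊤ : ℕ∞) fun p : ℝ × ℝ => stereoPullback s k c (fun x => u x p.2) p.1 := by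
  have hsy : ContDiff ℝ (⊤ : ℕ∞) fun p : ℝ × ℝ => s * p.1 := contDiff_const.mul contDiff_fst
  have hθ : ContDiff ℝ (⊤ : ℕ∞) fun p : ℝ × ℝ => c + 2 * arctan (s * p.1) :=
    contDiff_const.add (contDiff_const.mul hsy.arctan)
  have hS : ContDiff ℝ (⊤ : ℕ∞) fun p : ℝ × ℝ => √(1 + (s * p.1) ^ 2) :=
    (contDiff_const.add (hsy.pow 2)).sqrt fun p => by positivity
  exact (contDiff_const.mul hS).mul (hu.comp (hθ.prodMk contDiff_snd))

theorem hasDerivAt_stereoPullback_time {u : ℝ → ℝ → ℝ}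
    (hu : ContDiff ℝ (⊤ : ℕ∞) fun p : ℝ × ℝ => u p.1 p.2) (s k c y t : ℝ) :
    HasDerivAt (fun τ => stereoPullback s k c (fun x => u x τ) y)
      (k * √(1 + (s * y) ^ 2) * deriv (fun τ => u (c + 2 * arctan (s * y)) τ) t) t :=
  (differentiable_slice (u := fun t x => u x t) (contDiff_swap hu) _ t).hasDerivAt.const_mul _

theorem stereoPullback_inversion_one {v : ℝ → ℝ} {T : ℝ} (hT : 0 < T) (p : ℝ) :
    stereoPullback (-T⁻¹) T (p + π) v 1 = stereoPullback T 1 p v 1 := by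
  have h1 : p + π + 2 * arctan (-T⁻¹ * 1) = p + 2 * arctan (T * 1) := by
    rw [mul_one, mul_one, arctan_neg, arctan_inv_of_pos hT]
    ring
  have h2 : T * √(1 + (-T⁻¹ * 1) ^ 2) = √(1 + (T * 1) ^ 2) := by
    rw [← Real.sqrt_sq hT.le, ← Real.sqrt_mul (by positivity), Real.sqrt_sq hT.le]
    congr 1
    field_simp
    ring
  rw [stereoPullback, stereoPullback, h1, h2, one_mul]

theorem stereoPullback_inversion_neg_one {v : ℝ → ℝ} (hper : Function.Periodic v (2 * π))
    {T : ℝ} (hT : 0 < T) (p : ℝ) :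
    stereoPullback (-T⁻¹) T (p + π) v (-1) = stereoPullback T 1 p v (-1) := by
  have h1 : p + π + 2 * arctan (-T⁻¹ * -1) = p + 2 * arctan (T * -1) + 2 * π := by
    rw [neg_mul_neg, mul_one, mul_neg_one, arctan_neg, arctan_inv_of_pos hT]
    ring
  have h2 : T * √(1 + (-T⁻¹ * -1) ^ 2) = √(1 + (T * -1) ^ 2) := by
    rw [← Real.sqrt_sq hT.le, ← Real.sqrt_mul (by positivity), Real.sqrt_sq hT.le]
    congr 1
    field_simp
    ring
  rw [stereoPullback, stereoPullback, h1, h2, one_mul, hper]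

/-- The flow preserves domination of a solution over its inversion in an arc. -/
theorem stereoPullback_inversion_le_of_flow {u : ℝ → ℝ → ℝ} {ρ : ℝ → ℝ}
    (hu : ContDiff ℝ (⊤ : ℕ∞) fun p : ℝ × ℝ => u p.1 p.2)
    (hper : ∀ t, Function.Periodic (fun θ => u θ t) (2 * π)) (hρ : Continuous ρ)
    (hflow : ∀ θ t, 0 ≤ t → deriv (fun s => u θ s) t =
      u θ t ^ 4 * (deriv (deriv fun x => u x t) θ + u θ t / 4) - ρ t * u θ t)
    {T : ℝ} (hT : 0 < T) (p : ℝ)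
    (hinit : ∀ y ∈ Icc (-1 : ℝ) 1, stereoPullback (-T⁻¹) T (p + π) (fun x => u x 0) y ≤
      stereoPullback T 1 p (fun x => u x 0) y) {t : ℝ} (ht : 0 ≤ t) :
    ∀ y ∈ Icc (-1 : ℝ) 1, stereoPullback (-T⁻¹) T (p + π) (fun x => u x t) y ≤
      stereoPullback T 1 p (fun x => u x t) y := by
  set f : ℝ → ℝ → ℝ := fun y t => stereoPullback T 1 p (fun x => u x t) y
  set g : ℝ → ℝ → ℝ := fun y t => stereoPullback (-T⁻¹) T (p + π) (fun x => u x t) y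
  have hfc : ContDiff ℝ (⊤ : ℕ∞) fun q : ℝ × ℝ => f q.1 q.2 := contDiff_stereoPullback hu _ _ _
  have hgc : ContDiff ℝ (⊤ : ℕ∞) fun q : ℝ × ℝ => g q.1 q.2 := contDiff_stereoPullback hu _ _ _
  have hf1 := contDiff_partial_fst hfc
  have hg1 := contDiff_partial_fst hgc
  have hg2 := contDiff_partial_fst (u := fun y t => deriv (fun x => g x t) y) hg1
  have hf_evol : ∀ y t, 0 ≤ t →
      1 * √(1 + (T * y) ^ 2) * deriv (fun τ => u (p + 2 * arctan (T * y)) τ) t =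
      1 / (4 * T ^ 2) * f y t ^ 4 *
      deriv (deriv fun x => f x t) y - ρ t * f y t := fun y t ht => by
    have h := stereoPullback_evolution hu hflow hT.ne' one_ne_zero p y t ht
    rwa [one_pow, one_mul (T ^ 2)] at h
  have hg_evol : ∀ y t, 0 ≤ t → T * √(1 + (-T⁻¹ * y) ^ 2) *
      deriv (fun τ => u (p + π + 2 * arctan (-T⁻¹ * y)) τ) t =
      1 / (4 * T ^ 2) * g y t ^ 4 *
      deriv (deriv fun x => g x t) y - ρ t * g y t := fun y t ht => by
    have h := stereoPullback_evolution hu hflow (neg_ne_zero.2 (inv_ne_zero hT.ne')) hT.ne'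
      (p + π) y t ht
    rwa [show T ^ 4 * (-T⁻¹) ^ 2 = T ^ 2 by field_simp] at h
  have hmain := parabolic_minimum_principle (h := fun y t => f y t - g y t)
    (A := fun y t => 1 / (4 * T ^ 2) * f y t ^ 4)
    (b := fun y t => 1 / (4 * T ^ 2) * ((f y t + g y t) * (f y t ^ 2 + g y t ^ 2)) *
      deriv (deriv fun x => g x t) y - ρ t) ht
    (hfc.continuous.sub hgc.continuous) ?_ (fun y t => by positivity)
    (fun y t => (hasDerivAt_stereoPullback_time hu T 1 p y t).sub
      (hasDerivAt_stereoPullback_time hu (-T⁻¹) T (p + π) y t)) ?_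
    (fun y hy => sub_nonneg.2 (hinit y hy))
    (fun t _ => (sub_eq_zero.2 (stereoPullback_inversion_neg_one (hper t) hT p).symm).ge)
    (fun t _ => (sub_eq_zero.2 (stereoPullback_inversion_one hT p).symm).ge)
  · exact fun y hy => sub_nonneg.1 (hmain y hy)
  · have h1 := hfc.continuous
    have h2 := hgc.continuous
    have h3 := hg2.continuous
    have h4 : Continuous fun q : ℝ × ℝ => ρ q.2 := hρ.comp continuous_snd
    exact ((continuous_const.mul ((h1.add h2).mul ((h1.pow 2).add (h2.pow 2)))).mul h3).sub h4
  · intro y t ht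
    have hdd : deriv (deriv fun x => f x t - g x t) y =
        deriv (deriv fun x => f x t) y - deriv (deriv fun x => g x t) y := by
      have h1 : (deriv fun x => f x t - g x t) =
          fun y => deriv (fun x => f x t) y - deriv (fun x => g x t) y :=
        funext fun y => deriv_fun_sub (differentiable_slice hfc t y) (differentiable_slice hgc t y)
      rw [h1]
      exact deriv_fun_sub
        (differentiable_slice (u := fun y t => deriv (fun x => f x t) y) hf1 t y)
        (differentiable_slice (u := fun y t => deriv (fun x => g x t) y) hg1 t y)
    rw [hdd, hf_evol y t ht, hg_evol y t ht]
    ring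

/-- A positive function that dominates its inversion in the arc of half-width `2 arctan T` around
every point satisfies a gradient bound. -/
theorem abs_deriv_le_of_stereoPullback_inversion_le {v : ℝ → ℝ} (hv : Differentiable ℝ v)
    (hper : Function.Periodic v (2 * π)) (hpos : ∀ x, 0 < v x) {T : ℝ} (hT : 0 < T)
    (hle : ∀ p, ∀ y ∈ Icc (-1 : ℝ) 1,
      stereoPullback (-T⁻¹) T (p + π) v y ≤ stereoPullback T 1 p v y) (θ : ℝ) :
    |deriv v θ| ≤ 1 / (4 * T) * v θ := by
  have hS : 0 < √(1 + T ^ 2) := Real.sqrt_pos.2 (by positivity)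
  have hSinv : √(1 + T⁻¹ ^ 2) = √(1 + T ^ 2) / T := by
    rw [eq_div_iff hT.ne', ← Real.sqrt_sq hT.le, ← Real.sqrt_mul (by positivity),
      Real.sqrt_sq hT.le]
    congr 1
    field_simp
    ring
  have hper' : Function.Periodic (deriv v) (2 * π) := fun x => by
    rw [← deriv_comp_add_const]
    congr 1
    exact funext hper
  have hd : ∀ p y, HasDerivAt (fun y => stereoPullback T 1 p v y -
      stereoPullback (-T⁻¹) T (p + π) v y) _ y := fun p y =>
    (hasDerivAt_stereoPullback T 1 p (hv _).hasDerivAt).sub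
      (hasDerivAt_stereoPullback (-T⁻¹) T (p + π) (hv _).hasDerivAt)
  rw [abs_le]
  constructor
  · obtain ⟨p, rfl⟩ : ∃ p, p - 2 * arctan T = θ := ⟨θ + 2 * arctan T, by ring⟩
    have h1 : HasDerivAt (fun x : ℝ => -x) (-1) 1 := hasDerivAt_neg 1
    have h2 := (HasDerivAt.comp (1 : ℝ) (hd p (-1)) h1).nonpos_of_le_left
      (show (-1 : ℝ) < 1 by norm_num) fun x hx => by
        simp only [Function.comp]
        rw [stereoPullback_inversion_neg_one hper hT, sub_self]
        exact sub_nonneg.2 (hle p (-x) ⟨by linarith [hx.2], by linarith [hx.1]⟩)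
    have h3 : p + π + 2 * arctan (-T⁻¹ * -1) = p - 2 * arctan T + 2 * π := by
      rw [neg_mul_neg, mul_one, arctan_inv_of_pos hT]
      ring
    have h4 : p + 2 * arctan (T * -1) = p - 2 * arctan T := by
      rw [mul_neg_one, arctan_neg]
      ring
    rw [h3, h4, hper, hper', neg_mul_neg, mul_one, hSinv, mul_neg_one, neg_sq] at h2
    have hv0 := hpos (p - 2 * arctan T)
    set d := deriv v (p - 2 * arctan T)
    set w := v (p - 2 * arctan T)
    set S := √(1 + T ^ 2)
    have h5 : -(4 * T * d) + (T ^ 2 - 1) * w ≤ 0 := by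
      have : (-(4 * T * d) + (T ^ 2 - 1) * w) / S ≤ 0 := by
        convert h2 using 1
        field_simp
        ring
      exact nonpos_of_mul_nonpos_left (by rwa [div_eq_mul_inv] at this) (inv_pos.2 hS)
    rw [one_div_mul_eq_div, neg_le, ← sub_nonneg, sub_neg_eq_add]
    have h6 : w / (4 * T) + d = (w + 4 * T * d) / (4 * T) := by field_simp
    rw [h6]
    exact div_nonneg (by nlinarith [mul_nonneg (sq_nonneg T) hv0.le]) (by positivity)
  · obtain ⟨p, rfl⟩ : ∃ p, p + 2 * arctan T = θ := ⟨θ - 2 * arctan T, by ring⟩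
    have h2 := (hd p 1).nonpos_of_le_left (show (-1 : ℝ) < 1 by norm_num) fun x hx => by
        rw [stereoPullback_inversion_one hT, sub_self]
        exact sub_nonneg.2 (hle p x hx)
    have h3 : p + π + 2 * arctan (-T⁻¹ * 1) = p + 2 * arctan T := by
      rw [mul_one, arctan_neg, arctan_inv_of_pos hT]
      ring
    rw [h3, mul_one, mul_one (-T⁻¹), mul_one, neg_sq, hSinv] at h2
    have hv0 := hpos (p + 2 * arctan T)
    set d := deriv v (p + 2 * arctan T)
    set w := v (p + 2 * arctan T)
    set S := √(1 + T ^ 2)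
    have h5 : 4 * T * d + (T ^ 2 - 1) * w ≤ 0 := by
      have : (4 * T * d + (T ^ 2 - 1) * w) / S ≤ 0 := by
        convert h2 using 1
        field_simp
        ring
      exact nonpos_of_mul_nonpos_left (by rwa [div_eq_mul_inv] at this) (inv_pos.2 hS)
    rw [one_div_mul_eq_div, le_div_iff₀ (by positivity)]
    nlinarith [mul_nonneg (sq_nonneg T) hv0.le]

/-- Uniform-in-time Harnack gradient estimate for the normalized Yamabe flow
on S¹: there is `C > 0` with `|u_θ| ≤ C·u` for all θ and all t ≥ 0. -/
theorem yamabe_flow_harnack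
    (u : ℝ → ℝ → ℝ)
    (hu : ContDiff ℝ (⊤ : ℕ∞) (fun p : ℝ × ℝ => u p.1 p.2))
    (huper : ∀ θ t, u (θ + 2 * π) t = u θ t)
    (hupos : ∀ θ t, 0 < u θ t)
    (R : ℝ → ℝ → ℝ)
    (hR : ∀ θ t, R θ t = (u θ t) ^ 3 * (4 * deriv (deriv (fun x => u x t)) θ + u θ t))
    (Rbar : ℝ → ℝ)
    (hRbar : ∀ t, Rbar t =
      (∫ θ in (0:ℝ)..(2 * π), R θ t * ((u θ t) ^ 2)⁻¹) /
        ∫ θ in (0:ℝ)..(2 * π), ((u θ t) ^ 2)⁻¹)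
    (hflow : ∀ θ t, 0 ≤ t →
      deriv (fun s => u θ s) t = (1 / 4) * (R θ t - Rbar t) * u θ t)
    (hnorm : ∫ θ in (0:ℝ)..(2 * π), ((u θ 0) ^ 2)⁻¹ = 2 * π) :
    ∃ C : ℝ, 0 < C ∧
      ∀ θ t : ℝ, 0 ≤ t → |deriv (fun x => u x t) θ| ≤ C * u θ t := by
  have hper : ∀ t, Function.Periodic (fun θ => u θ t) (2 * π) := fun t θ => huper θ t
  set ρ : ℝ → ℝ := fun t =>
    u 0 t ^ 3 * (deriv (deriv fun x => u x t) 0 + u 0 t / 4) - deriv (fun s => u 0 s) t / u 0 t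
    with hρ_def
  have hρ_eq : ∀ t, 0 ≤ t → ρ t = Rbar t / 4 := fun t ht => by
    simp only [hρ_def]
    rw [hflow 0 t ht, hR]
    have := (hupos 0 t).ne'
    field_simp
    ring
  have hρ : Continuous ρ := by
    have hline : Continuous fun t : ℝ => ((0 : ℝ), t) := by fun_prop
    have h0 : Continuous fun t => u 0 t := hu.continuous.comp hline
    have h2 : Continuous fun t => deriv (deriv fun x => u x t) 0 :=
      (contDiff_partial_fst (u := fun θ t => deriv (fun x => u x t) θ)
        (contDiff_partial_fst hu)).continuous.comp hline
    have h1 : Continuous fun t => deriv (fun s => u 0 s) t :=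
      (contDiff_partial_fst (u := fun t x => u x t) (contDiff_swap hu)).continuous.comp
        (show Continuous fun t : ℝ => (t, (0 : ℝ)) by fun_prop)
    exact ((h0.pow 3).mul (h2.add (h0.div_const 4))).sub (h1.div h0 fun t => (hupos 0 t).ne')
  have hflow' : ∀ θ t, 0 ≤ t → deriv (fun s => u θ s) t =
      u θ t ^ 4 * (deriv (deriv fun x => u x t) θ + u θ t / 4) - ρ t * u θ t :=
    fun θ t ht => by
      rw [hflow θ t ht, hρ_eq t ht, hR]
      ring
  obtain ⟨L, hL, hharn⟩ := exists_le_mul_one_add (v := fun θ => u θ 0) two_pi_pos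
    ((hu.comp (contDiff_id.prodMk contDiff_const)).of_le (by exact_mod_cast le_top)) (hper 0)
    fun θ => hupos θ 0
  obtain ⟨T, η, hη, hT, hT2, hη1, hLT⟩ := exists_small_parameters hL
  refine ⟨1 / (4 * T), by positivity, fun θ t ht => ?_⟩
  exact abs_deriv_le_of_stereoPullback_inversion_le (differentiable_slice hu t) (hper t)
    (fun θ => hupos θ t) hT (fun p => stereoPullback_inversion_le_of_flow hu hper hρ hflow' hT p
      (stereoPullback_inversion_le hL (hper 0) (fun θ => hupos θ 0) hharn hη hT hT2 hη1 hLT p) ht) θ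
end
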